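/- Let g ≥ 2. The set of matrices A ∈ Sp(2g, ℤ) whose characteristic polynomial f ∈ ℤ[x] satisfies at least one of the following three conditions is exponentially small in Sp(2g, ℤ): (a) f is reducible over ℚ; (b) f has a complex root which is a root of unity, i.e. there exist k ≥ 1 and ζ ∈ ℂ with ζ^k = 1 and f(ζ) = 0; (c) there exist an integer d ≥ 2 and a polynomial h ∈ ℤ[x] such that f(x) = h(x^d). -/

import Mathlib

/-- The probability that the `k`-th step of the random walk driven by the uniform measure on
the finite set `S` lies in the set `Z`. -/
noncomputable def walkProb {G : Type*} [Group G] (S : Finset G) (k : ℕ) (Z : Set G) : ℝ :=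
  (Nat.card {w : Fin k → S // (List.ofFn fun i => ((w i : G))).prod ∈ Z} : ℝ) /
    (S.card : ℝ) ^ k

/-- `Z` is exponentially small with respect to `S`. -/
def ExpSmallWrt {G : Type*} [Group G] (S : Finset G) (Z : Set G) : Prop :=
  ∃ c α : ℝ, 0 < c ∧ 0 < α ∧ ∀ k : ℕ, walkProb S k Z ≤ c * Real.exp (-α * k)

/-- `S` is an admissible subset: symmetric, generating, and satisfying an odd relation. -/
def Admissible {G : Type*} [Group G] (S : Finset G) : Prop :=
  (∀ x : G, x ∈ S ↔ x⁻¹ ∈ S) ∧ Subgroup.closure (S : Set G) = ⊤ ∧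
    ∃ k : ℕ, Odd k ∧ ∃ w : Fin k → S, (List.ofFn fun i => ((w i : G))).prod = 1

/-- `Z` is exponentially small: exponentially small with respect to every admissible set. -/
def ExpSmall {G : Type*} [Group G] (Z : Set G) : Prop :=
  ∀ S : Finset G, Admissible S → ExpSmallWrt S Z

section Walk

variable {G : Type*} [Group G]

/-- The expectation of `F` at the `k`-th step of the random walk driven by `S`. -/
noncomputable def walkAvg (S : Finset G) (k : ℕ) (F : G → ℝ) : ℝ :=
  (∑ w : Fin k → S, F (List.ofFn fun i => (w i : G)).prod) / (S.card : ℝ) ^ k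

theorem walkProb_eq_walkAvg (S : Finset G) (k : ℕ) (Z : Set G) :
    walkProb S k Z = walkAvg S k (Z.indicator 1) := by
  classical
  unfold walkProb walkAvg
  congr 1
  rw [Nat.card_eq_fintype_card, Fintype.card_subtype]
  simp [Set.indicator_apply]

theorem walkAvg_mono (S : Finset G) (k : ℕ) {F F' : G → ℝ} (h : ∀ x, F x ≤ F' x) :
    walkAvg S k F ≤ walkAvg S k F' := by
  unfold walkAvg
  gcongr
  exact h _

theorem walkAvg_sum {ι : Type*} (S : Finset G) (k : ℕ) (s : Finset ι) (F : ι → G → ℝ) :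
    walkAvg S k (fun x => ∑ i ∈ s, F i x) = ∑ i ∈ s, walkAvg S k (F i) := by
  unfold walkAvg
  rw [Finset.sum_comm, Finset.sum_div]

theorem walkAvg_const_mul (S : Finset G) (k : ℕ) (c : ℝ) (F : G → ℝ) :
    walkAvg S k (fun x => c * F x) = c * walkAvg S k F := by
  unfold walkAvg
  rw [← Finset.mul_sum, mul_div_assoc]

theorem walkAvg_le_one (S : Finset G) (k : ℕ) {F : G → ℝ} (h : ∀ x, F x ≤ 1) :
    walkAvg S k F ≤ 1 := by
  unfold walkAvg
  refine div_le_one_of_le₀ ((Finset.sum_le_sum fun w _ => h _).trans ?_) (by positivity)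
  simp

theorem walkProb_le_one (S : Finset G) (k : ℕ) (Z : Set G) : walkProb S k Z ≤ 1 := by
  rw [walkProb_eq_walkAvg]
  classical
  exact walkAvg_le_one S k fun x => by rw [Set.indicator_apply]; split_ifs <;> simp

/-- Second moment bound: if every `f i` is at most `-δ` on `Z` and the `f i` are nearly
uncorrelated, then `Z` has small probability. -/
theorem walkProb_le_of_correlation {ι : Type*} (S : Finset G) (k : ℕ) (Z : Set G)
    (P : Finset ι) (hP : P.Nonempty) (f : ι → G → ℝ) {δ τ : ℝ} (hδ : 0 < δ) (hτ : 0 ≤ τ)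
    (hf : ∀ i ∈ P, ∀ x, |f i x| ≤ 1) (hZ : ∀ i ∈ P, ∀ x ∈ Z, f i x ≤ -δ)
    (hcor : ∀ i ∈ P, ∀ j ∈ P, i ≠ j → walkAvg S k (fun x => f i x * f j x) ≤ τ) :
    walkProb S k Z ≤ (1 / δ ^ 2) * (1 / P.card + τ) := by
  classical
  have hc : (0 : ℝ) < P.card := by exact_mod_cast hP.card_pos
  have h1 : ∀ x, (δ ^ 2 * (P.card : ℝ) ^ 2) * Z.indicator 1 x ≤
      ∑ i ∈ P, ∑ j ∈ P, f i x * f j x := by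
    intro x
    rw [← Finset.sum_mul_sum, ← sq]
    by_cases hx : x ∈ Z
    · have : ∑ i ∈ P, f i x ≤ ∑ i ∈ P, -δ := Finset.sum_le_sum fun i hi => hZ i hi x hx
      simp only [Finset.sum_const, nsmul_eq_mul] at this
      simp only [Set.indicator_of_mem hx, Pi.one_apply, mul_one]
      nlinarith [mul_pos hc hδ]
    · simp only [Set.indicator_of_notMem hx, mul_zero]
      positivity
  have h2 := walkAvg_mono S k h1
  rw [walkAvg_const_mul, walkAvg_sum, ← walkProb_eq_walkAvg] at h2
  simp_rw [walkAvg_sum] at h2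
  have h3 : ∑ i ∈ P, ∑ j ∈ P, walkAvg S k (fun x => f i x * f j x) ≤
      ∑ i ∈ P, ∑ j ∈ P, ((if i = j then 1 else 0) + τ) := by
    refine Finset.sum_le_sum fun i hi => Finset.sum_le_sum fun j hj => ?_
    split_ifs with hij
    · refine (walkAvg_le_one S k fun x => ?_).trans (by linarith)
      have h1 := abs_le.1 (hf i hi x)
      have h2 := abs_le.1 (hf j hj x)
      nlinarith
    · simpa using hcor i hi j hj hij
  have h4 : ∑ i ∈ P, ∑ j ∈ P, ((if i = j then (1 : ℝ) else 0) + τ) =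
      P.card + (P.card : ℝ) ^ 2 * τ := by
    simp only [Finset.sum_add_distrib, Finset.sum_ite_eq, Finset.sum_const, nsmul_eq_mul]
    simp
    ring
  have h5 := h2.trans (h3.trans h4.le)
  have : (1 / δ ^ 2) * (1 / P.card + τ) =
      (P.card + (P.card : ℝ) ^ 2 * τ) / (δ ^ 2 * (P.card : ℝ) ^ 2) := by
    field_simp
  rw [this, le_div_iff₀ (by positivity)]
  linarith

theorem walkAvg_zero (S : Finset G) (F : G → ℝ) : walkAvg S 0 F = F 1 := by
  simp [walkAvg]

theorem walkAvg_succ (S : Finset G) (k : ℕ) (F : G → ℝ) :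
    walkAvg S (k + 1) F = walkAvg S k (fun x => (∑ s : S, F (s * x)) / S.card) := by
  unfold walkAvg
  rw [← (Fin.consEquiv fun _ => S).sum_comp, Fintype.sum_prod_type_right, ← Finset.sum_div,
    div_div, pow_succ']
  simp [Fin.consEquiv, List.ofFn_succ]

end Walk

section Regular

variable {H : Type} [Group H] [Fintype H]

/-- The left regular representation on functions on a finite group. -/
noncomputable def regularRep (H : Type) [Group H] [Fintype H] :
    H →* (EuclideanSpace ℂ H ≃ₗᵢ[ℂ] EuclideanSpace ℂ H) where
  toFun h := LinearIsometryEquiv.piLpCongrLeft 2 ℂ ℂ (Equiv.mulLeft h)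
  map_one' := by
    ext f x
    simp only [LinearIsometryEquiv.piLpCongrLeft_apply, Equiv.mulLeft_one]
    rfl
  map_mul' a b := by
    ext f x
    simp [LinearIsometryEquiv.piLpCongrLeft_apply, Equiv.piCongrLeft', Equiv.Perm.mul_def]

theorem regularRep_apply (h : H) (f : EuclideanSpace ℂ H) (x : H) :
    regularRep H h f x = f (h⁻¹ * x) := by
  simp [regularRep, LinearIsometryEquiv.piLpCongrLeft_apply, Equiv.piCongrLeft']

theorem abs_walkAvg_le_of_gap {G : Type*} [Group G] (S : Finset G) (hS : ∀ x : G, x ∈ S ↔ x⁻¹ ∈ S)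
    (φ : G →* H) {r : ℝ} (hr : 0 ≤ r)
    (hgap : ∀ f : EuclideanSpace ℂ H, ∑ x, f x = 0 →
      ‖∑ s ∈ S, regularRep H (φ s) f‖ ≤ r * S.card * ‖f‖) (k : ℕ) :
    ∀ F : H → ℝ, ∑ x, F x = 0 → |walkAvg S k (fun x => F (φ x))| ≤
      r ^ k * ‖(WithLp.toLp 2 fun x => (F x : ℂ) : EuclideanSpace ℂ H)‖ := by
  induction k with
  | zero =>
    intro F hF
    rw [walkAvg_zero]
    have := PiLp.norm_apply_le (WithLp.toLp 2 fun x => (F x : ℂ) : EuclideanSpace ℂ H) (φ 1)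
    simpa using this
  | succ k ih =>
    intro F hF
    rw [walkAvg_succ]
    rcases S.eq_empty_or_nonempty with rfl | hne
    · simp [walkAvg]
      positivity
    have hc : (0 : ℝ) < S.card := by exact_mod_cast hne.card_pos
    set F' : H → ℝ := fun y => (∑ s : S, F (φ s * y)) / S.card with hF'
    have h0 : ∑ y, F' y = 0 := by
      rw [hF', ← Finset.sum_div, Finset.sum_comm]
      simp [Fintype.sum_equiv (Equiv.mulLeft (φ _)) (fun y => F (φ _ * y)) F (fun _ => rfl), hF]
    have h1 : (WithLp.toLp 2 fun x => (F' x : ℂ) : EuclideanSpace ℂ H) =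
        (S.card : ℂ)⁻¹ • ∑ s ∈ S, regularRep H (φ s)
          (WithLp.toLp 2 fun x => (F x : ℂ) : EuclideanSpace ℂ H) := by
      ext y
      simp only [hF', PiLp.smul_apply, WithLp.ofLp_sum, Finset.sum_apply, regularRep_apply,
        smul_eq_mul]
      push_cast
      rw [div_eq_inv_mul]
      congr 1
      rw [Finset.sum_coe_sort S fun s => (F (φ s * y) : ℂ)]
      refine Finset.sum_bij' (fun s _ => s⁻¹) (fun s _ => s⁻¹) ?_ ?_ ?_ ?_ ?_
      · intro s hs; exact (hS s).1 hs
      · intro s hs; exact (hS s).1 hs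
      · simp
      · simp
      · simp
    have h2 := ih F' h0
    have h3 := hgap (WithLp.toLp 2 fun x => (F x : ℂ))
      (by simpa using congrArg (fun x : ℝ => (x : ℂ)) hF)
    have h4 : (fun x => F' (φ x)) = fun x => (∑ s : S, F (φ (s * x))) / S.card := by
      simp [hF']
    rw [h4] at h2
    refine h2.trans ?_
    rw [h1, norm_smul, pow_succ, mul_assoc]
    refine mul_le_mul_of_nonneg_left ?_ (by positivity)
    rw [norm_inv, Complex.norm_natCast, inv_mul_le_iff₀ hc]
    linarith

end Regular

section Kazhdan

variable {G : Type*} [Group G] {V : Type*} [NormedAddCommGroup V] [InnerProductSpace ℂ V]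

theorem isometryRep_mul_apply (ρ : G →* (V ≃ₗᵢ[ℂ] V)) (a b : G) (v : V) :
    ρ (a * b) v = ρ a (ρ b v) := by
  rw [map_mul]; rfl

theorem norm_map_mul_sub_le (ρ : G →* (V ≃ₗᵢ[ℂ] V)) (a b : G) (v : V) :
    ‖ρ (a * b) v - v‖ ≤ ‖ρ a v - v‖ + ‖ρ b v - v‖ := by
  have : ρ (a * b) v - v = ρ a (ρ b v - v) + (ρ a v - v) := by
    rw [isometryRep_mul_apply, map_sub]; abel
  rw [this, add_comm]
  refine (norm_add_le _ _).trans ?_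
  rw [LinearIsometryEquiv.norm_map]

theorem norm_map_list_prod_sub_le (ρ : G →* (V ≃ₗᵢ[ℂ] V)) (v : V) {c : ℝ} (l : List G)
    (h : ∀ x ∈ l, ‖ρ x v - v‖ ≤ c) : ‖ρ l.prod v - v‖ ≤ l.length * c := by
  induction l with
  | nil => simp
  | cons a l ih =>
    rw [List.prod_cons]
    refine (norm_map_mul_sub_le ρ a l.prod v).trans ?_
    have h1 := h a (by simp)
    have h2 := ih fun x hx => h x (by simp [hx])
    rw [List.length_cons]
    push_cast
    linarith

theorem norm_map_pow_sub_le (ρ : G →* (V ≃ₗᵢ[ℂ] V)) (v : V) (a : G) (n : ℕ) :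
    ‖ρ (a ^ n) v - v‖ ≤ n * ‖ρ a v - v‖ := by
  have := norm_map_list_prod_sub_le ρ v (c := ‖ρ a v - v‖) (List.replicate n a)
    (by simp +contextual [List.mem_replicate])
  simpa using this

/-- The quotients `s⁻¹ t` of an admissible set generate the group. -/
theorem closure_quotients_eq_top (S : Finset G) (hS : Admissible S) :
    Subgroup.closure {x : G | ∃ s ∈ S, ∃ t ∈ S, x = s⁻¹ * t} = ⊤ := by
  obtain ⟨hsymm, hgen, k, hk, w, hw⟩ := hS
  set N := Subgroup.closure {x : G | ∃ s ∈ S, ∃ t ∈ S, x = s⁻¹ * t} with hN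
  have hmul : ∀ s ∈ S, ∀ t ∈ S, s * t ∈ N := fun s hs t ht =>
    Subgroup.subset_closure ⟨s⁻¹, (hsymm s).1 hs, t, ht, by simp⟩
  have key : ∀ l : List G, (∀ x ∈ l, x ∈ S) → (Even l.length → l.prod ∈ N) ∧
      (Odd l.length → ∀ s ∈ S, s * l.prod ∈ N) := by
    intro l
    induction l with
    | nil => simp
    | cons a l ih =>
      intro h
      obtain ⟨h1, h2⟩ := ih fun x hx => h x (by simp [hx])
      rw [List.length_cons, List.prod_cons]
      refine ⟨fun he => h2 (by grind) a (h a (by simp)), fun ho s hs => ?_⟩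
      rw [← mul_assoc]
      exact N.mul_mem (hmul s hs a (h a (by simp))) (h1 (by grind))
  have h := (key (List.ofFn fun i => (w i : G)) (by simp [List.mem_ofFn])).2 (by simpa using hk)
  rw [hw] at h
  rw [eq_top_iff, ← hgen, Subgroup.closure_le]
  intro s hs
  simpa using h s hs

/-- A Kazhdan pair `(T, ε)` for a vector gives a contraction by the averaging operator of any
admissible set, uniformly in the unitary representation. -/
theorem exists_contraction_of_kazhdan (S : Finset G) (hS : Admissible S) (T : Finset G) {ε : ℝ}
    (hε : 0 < ε) : ∃ r : ℝ, 0 < r ∧ r < 1 ∧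
      ∀ (V : Type) [NormedAddCommGroup V] [InnerProductSpace ℂ V] (ρ : G →* (V ≃ₗᵢ[ℂ] V)) (v : V),
        (∃ t ∈ T, ε * ‖v‖ ≤ ‖ρ t v - v‖) → ‖∑ s ∈ S, ρ s v‖ ≤ r * S.card * ‖v‖ := by
  classical
  set Q : Set G := {x : G | ∃ s ∈ S, ∃ t ∈ S, x = s⁻¹ * t} with hQ
  have hl : ∀ x : G, ∃ l : List G, (∀ y ∈ l, y ∈ Q) ∧ l.prod = x := by
    intro x
    have hx : x ∈ Subgroup.closure Q := by rw [closure_quotients_eq_top S hS]; trivial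
    rw [← Subgroup.mem_toSubmonoid, Subgroup.closure_toSubmonoid] at hx
    have hQi : Q ∪ Q⁻¹ = Q := by
      refine Set.union_eq_left.2 ?_
      rintro x ⟨s, hs, t, ht, h⟩
      exact ⟨t, ht, s, hs, by rw [← inv_inv x, h]; simp⟩
    rw [hQi] at hx
    exact Submonoid.exists_list_of_mem_closure hx
  choose l hlQ hlp using hl
  obtain ⟨L, hL⟩ := (T.image fun t => (l t).length).exists_le
  have hL' : ∀ t ∈ T, (l t).length ≤ L := fun t ht => hL _ (Finset.mem_image_of_mem _ ht)
  set ε' : ℝ := min 1 (ε / (L + 1)) with hε'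
  have hε'0 : 0 < ε' := by positivity
  have hcard : 0 < S.card := by
    obtain ⟨_, _, k, hk, w, _⟩ := hS
    exact Finset.card_pos.2 ⟨_, (w ⟨0, hk.pos⟩).2⟩
  have hcard' : (0 : ℝ) < S.card := by exact_mod_cast hcard
  set q : ℝ := √(4 - ε' ^ 2) with hq
  have hε1 : ε' ≤ 1 := min_le_left _ _
  have hq0 : 0 < q := Real.sqrt_pos.2 (by nlinarith)
  have hq2 : q < 2 := by
    rw [hq, Real.sqrt_lt' (by norm_num)]
    nlinarith
  have hq1 : q ^ 2 = 4 - ε' ^ 2 := Real.sq_sqrt (by nlinarith)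
  refine ⟨max (1 / 2) (((S.card : ℝ) - 2 + q) / S.card), by positivity,
    max_lt (by norm_num) (by rw [div_lt_one hcard']; linarith), ?_⟩
  intro V _ _ ρ v ⟨t, ht, htv⟩
  rcases eq_or_ne v 0 with rfl | hv
  · simp
  have hv0 : 0 < ‖v‖ := norm_pos_iff.2 hv
  have hex : ∃ a ∈ S, ∃ b ∈ S, ε' * ‖v‖ ≤ ‖ρ a v - ρ b v‖ := by
    by_contra! hcon
    have h1 := norm_map_list_prod_sub_le ρ v (c := ε' * ‖v‖) (l t) fun x hx => by
      obtain ⟨a, ha, b, hb, rfl⟩ := hlQ t x hx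
      have : ρ (a⁻¹ * b) v - v = ρ a⁻¹ (ρ b v - ρ a v) := by
        rw [map_sub, ← isometryRep_mul_apply, ← isometryRep_mul_apply]; simp
      rw [this, LinearIsometryEquiv.norm_map]
      exact (hcon b hb a ha).le
    rw [hlp] at h1
    have h2 : ((l t).length : ℝ) ≤ L := by exact_mod_cast hL' t ht
    have h3 : ε' * (L + 1) ≤ ε := by
      rw [← le_div_iff₀ (by positivity)]; exact min_le_right _ _
    have h4 : ((l t).length : ℝ) * (ε' * ‖v‖) ≤ L * (ε' * ‖v‖) := by gcongr
    nlinarith [mul_pos hε'0 hv0]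
  obtain ⟨a, ha, b, hb, hab⟩ := hex
  have hne : a ≠ b := by
    rintro rfl
    simp only [sub_self, norm_zero] at hab
    nlinarith [mul_pos hε'0 hv0]
  have hsum : ∑ s ∈ S, ρ s v = (ρ a v + ρ b v) + ∑ s ∈ (S.erase a).erase b, ρ s v := by
    rw [← Finset.add_sum_erase S _ ha, ← Finset.add_sum_erase (S.erase a) _
      (Finset.mem_erase.2 ⟨hne.symm, hb⟩), add_assoc]
  have hpar := parallelogram_law_with_norm ℂ (ρ a v) (ρ b v)
  simp only [LinearIsometryEquiv.norm_map] at hpar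
  have hab2 : ‖ρ a v + ρ b v‖ ≤ q * ‖v‖ := by
    refine abs_le_of_sq_le_sq' ?_ (by positivity) |>.2
    rw [mul_pow, hq1]
    have : (ε' * ‖v‖) ^ 2 ≤ ‖ρ a v - ρ b v‖ ^ 2 := by gcongr
    nlinarith
  have hrest : ‖∑ s ∈ (S.erase a).erase b, ρ s v‖ ≤ (S.card - 2) * ‖v‖ := by
    refine (norm_sum_le _ _).trans ?_
    simp only [LinearIsometryEquiv.norm_map, Finset.sum_const, nsmul_eq_mul]
    gcongr
    have h1 := Finset.card_erase_add_one ha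
    have h2 := Finset.card_erase_add_one (Finset.mem_erase.2 ⟨hne.symm, hb⟩)
    have : ((((S.erase a).erase b).card + 2 : ℕ) : ℝ) = S.card := by
      exact_mod_cast by omega
    push_cast at this
    linarith
  calc ‖∑ s ∈ S, ρ s v‖ ≤ q * ‖v‖ + (S.card - 2) * ‖v‖ := by
        rw [hsum]; exact (norm_add_le _ _).trans (add_le_add hab2 hrest)
    _ = (((S.card : ℝ) - 2 + q) / S.card) * S.card * ‖v‖ := by field_simp; ring
    _ ≤ _ := by gcongr; exact le_max_right _ _

end Kazhdan

section Spectral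

variable {A : Type*} [AddCommGroup A] [Fintype A] {V : Type*} [NormedAddCommGroup V]
  [InnerProductSpace ℂ V]

/-- The projection to the `χ`-isotypic part of a unitary representation of a finite abelian
group. -/
noncomputable def specProj (n : Multiplicative A →* (V ≃ₗᵢ[ℂ] V)) (χ : AddChar A ℂ) (v : V) : V :=
  (Fintype.card A : ℂ)⁻¹ • ∑ a, χ (-a) • n (Multiplicative.ofAdd a) v

theorem specProj_sub (n : Multiplicative A →* (V ≃ₗᵢ[ℂ] V)) (χ : AddChar A ℂ) (v w : V) :
    specProj n χ (v - w) = specProj n χ v - specProj n χ w := by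
  simp [specProj, smul_sub, Finset.sum_sub_distrib]

theorem sum_specProj (n : Multiplicative A →* (V ≃ₗᵢ[ℂ] V)) (v : V) :
    ∑ χ, specProj n χ v = v := by
  classical
  unfold specProj
  rw [← Finset.smul_sum, Finset.sum_comm]
  simp_rw [← Finset.sum_smul, AddChar.sum_apply_eq_ite]
  simp [Fintype.card_ne_zero]

theorem map_specProj (n : Multiplicative A →* (V ≃ₗᵢ[ℂ] V)) (χ : AddChar A ℂ) (a : A) (v : V) :
    n (Multiplicative.ofAdd a) (specProj n χ v) = χ a • specProj n χ v := by
  unfold specProj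
  rw [map_smul, map_sum, smul_comm (χ a), Finset.smul_sum (r := χ a)]
  congr 1
  refine Fintype.sum_equiv (Equiv.addLeft a) _ _ fun b => ?_
  rw [LinearIsometryEquiv.map_smul, ← isometryRep_mul_apply, smul_smul,
    ← AddChar.map_add_eq_mul, ← ofAdd_add]
  simp

theorem specProj_intertwine (n : Multiplicative A →* (V ≃ₗᵢ[ℂ] V)) (m : V ≃ₗᵢ[ℂ] V)
    (τ : A ≃+ A) (hm : ∀ a v, m (n (Multiplicative.ofAdd a) v) =
      n (Multiplicative.ofAdd (τ a)) (m v)) (χ : AddChar A ℂ) (v : V) :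
    specProj n χ (m v) = m (specProj n (χ.compAddMonoidHom τ.toAddMonoidHom) v) := by
  unfold specProj
  rw [map_smul, map_sum]
  congr 1
  refine (Fintype.sum_equiv τ.toEquiv _ _ fun b => ?_).symm
  rw [map_smul, hm]
  simp

theorem inner_specProj_eq_zero (n : Multiplicative A →* (V ≃ₗᵢ[ℂ] V)) {χ ψ : AddChar A ℂ}
    (h : χ ≠ ψ) (v w : V) : inner ℂ (specProj n χ v) (specProj n ψ w) = 0 := by
  obtain ⟨a, ha⟩ : ∃ a, χ a ≠ ψ a := by
    by_contra! hcon
    exact h (DFunLike.ext _ _ hcon)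
  have h1 := (n (Multiplicative.ofAdd a)).inner_map_map (specProj n χ v) (specProj n ψ w)
  rw [map_specProj, map_specProj, inner_smul_left, inner_smul_right, ← mul_assoc] at h1
  by_contra h0
  have h2 : (starRingEnd ℂ) (χ a) * ψ a = 1 := mul_right_cancel₀ h0 (h1.trans (one_mul _).symm)
  have h3 : χ a * (starRingEnd ℂ) (χ a) = 1 := by
    rw [Complex.mul_conj, Complex.normSq_eq_norm_sq, AddChar.norm_apply]; simp
  apply ha
  calc χ a = χ a * ((starRingEnd ℂ) (χ a) * ψ a) := by rw [h2, mul_one]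
    _ = ψ a := by rw [← mul_assoc, h3, one_mul]

theorem norm_sum_smul_specProj_sq (n : Multiplicative A →* (V ≃ₗᵢ[ℂ] V))
    (B : Finset (AddChar A ℂ)) (c : AddChar A ℂ → ℂ) (v : V) :
    ‖∑ χ ∈ B, c χ • specProj n χ v‖ ^ 2 = ∑ χ ∈ B, ‖c χ‖ ^ 2 * ‖specProj n χ v‖ ^ 2 := by
  classical
  induction B using Finset.induction_on with
  | empty => simp
  | insert χ B hχ ih =>
    rw [Finset.sum_insert hχ, Finset.sum_insert hχ, ← ih, sq, sq ‖∑ χ ∈ B, _‖,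
      norm_add_sq_eq_norm_sq_add_norm_sq_of_inner_eq_zero (𝕜 := ℂ), norm_smul]
    · ring
    · rw [inner_sum]
      refine Finset.sum_eq_zero fun ψ hψ => ?_
      rw [inner_smul_left, inner_smul_right, inner_specProj_eq_zero n (by grind)]
      simp

/-- The spectral mass of `v` on a set of characters. -/
noncomputable def specMass (n : Multiplicative A →* (V ≃ₗᵢ[ℂ] V)) (v : V)
    (B : Finset (AddChar A ℂ)) : ℝ :=
  ∑ χ ∈ B, ‖specProj n χ v‖ ^ 2

theorem specMass_eq_norm_sq (n : Multiplicative A →* (V ≃ₗᵢ[ℂ] V)) (v : V)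
    (B : Finset (AddChar A ℂ)) : specMass n v B = ‖∑ χ ∈ B, specProj n χ v‖ ^ 2 := by
  simpa [specMass] using (norm_sum_smul_specProj_sq n B (fun _ => 1) v).symm

theorem specMass_univ (n : Multiplicative A →* (V ≃ₗᵢ[ℂ] V)) (v : V) :
    specMass n v Finset.univ = ‖v‖ ^ 2 := by
  rw [specMass_eq_norm_sq, sum_specProj]

theorem specMass_mono (n : Multiplicative A →* (V ≃ₗᵢ[ℂ] V)) (v : V)
    {B B' : Finset (AddChar A ℂ)} (h : B ⊆ B') : specMass n v B ≤ specMass n v B' :=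
  Finset.sum_le_sum_of_subset_of_nonneg h fun _ _ _ => by positivity

theorem specMass_nonneg (n : Multiplicative A →* (V ≃ₗᵢ[ℂ] V)) (v : V)
    (B : Finset (AddChar A ℂ)) : 0 ≤ specMass n v B :=
  Finset.sum_nonneg fun _ _ => by positivity

theorem specMass_le_add_norm_sub (n : Multiplicative A →* (V ≃ₗᵢ[ℂ] V)) (v w : V)
    (B : Finset (AddChar A ℂ)) :
    specMass n v B ≤ specMass n w B + ‖w - v‖ * (‖v‖ + ‖w‖) := by
  have hle : ∀ u, ‖∑ χ ∈ B, specProj n χ u‖ ≤ ‖u‖ := fun u => by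
    refine abs_le_of_sq_le_sq' ?_ (norm_nonneg _) |>.2
    rw [← specMass_eq_norm_sq, ← specMass_univ n u]
    exact specMass_mono n u (Finset.subset_univ B)
  have h1 := hle v
  have h2 := hle w
  have h3 := hle (w - v)
  simp_rw [specProj_sub, Finset.sum_sub_distrib] at h3
  have h4 := (norm_sub_norm_le (∑ χ ∈ B, specProj n χ v) (∑ χ ∈ B, specProj n χ w))
  rw [norm_sub_rev] at h4
  rw [specMass_eq_norm_sq, specMass_eq_norm_sq]
  have h5 : 0 ≤ ‖∑ χ ∈ B, specProj n χ v‖ := norm_nonneg _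
  have h6 : 0 ≤ ‖∑ χ ∈ B, specProj n χ w‖ := norm_nonneg _
  nlinarith [mul_le_mul_of_nonneg_right (h4.trans h3) (add_nonneg h5 h6),
    mul_le_mul_of_nonneg_left (add_le_add h1 h2) (norm_nonneg (w - v))]

theorem norm_map_sub_sq_eq_sum (n : Multiplicative A →* (V ≃ₗᵢ[ℂ] V)) (a : A) (v : V) :
    ‖n (Multiplicative.ofAdd a) v - v‖ ^ 2 = ∑ χ, ‖χ a - 1‖ ^ 2 * ‖specProj n χ v‖ ^ 2 := by
  rw [← norm_sum_smul_specProj_sq]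
  congr 2
  simp_rw [sub_smul, one_smul, Finset.sum_sub_distrib, ← map_specProj, ← map_sum, sum_specProj]

/-- If almost all the spectral mass sits at the trivial character, then the vector is almost
invariant. -/
theorem norm_map_sub_sq_le_specMass (n : Multiplicative A →* (V ≃ₗᵢ[ℂ] V)) (a : A) (v : V)
    [DecidableEq (AddChar A ℂ)] :
    ‖n (Multiplicative.ofAdd a) v - v‖ ^ 2 ≤ 4 * specMass n v (Finset.univ.erase 0) := by
  rw [norm_map_sub_sq_eq_sum, specMass, Finset.mul_sum,
    ← Finset.add_sum_erase _ _ (Finset.mem_univ (0 : AddChar A ℂ))]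
  simp only [AddChar.zero_apply, sub_self, norm_zero]
  rw [zero_pow (by norm_num), zero_mul, zero_add]
  refine Finset.sum_le_sum fun χ _ => ?_
  gcongr
  have : ‖χ a - 1‖ ≤ 2 := by
    refine (norm_sub_le _ _).trans ?_
    rw [AddChar.norm_apply]; norm_num
  nlinarith [norm_nonneg (χ a - 1)]

/-- Markov inequality for the spectral mass. -/
theorem specMass_le_of_norm_sub_one (n : Multiplicative A →* (V ≃ₗᵢ[ℂ] V)) (a : A) (v : V)
    (B : Finset (AddChar A ℂ)) {c : ℝ} (hc : 0 ≤ c) (hB : ∀ χ ∈ B, c ≤ ‖χ a - 1‖) :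
    c ^ 2 * specMass n v B ≤ ‖n (Multiplicative.ofAdd a) v - v‖ ^ 2 := by
  rw [norm_map_sub_sq_eq_sum, specMass, Finset.mul_sum]
  refine (Finset.sum_le_sum fun χ hχ => ?_).trans
    (Finset.sum_le_sum_of_subset_of_nonneg (Finset.subset_univ B) fun _ _ _ => by positivity)
  have := hB χ hχ
  gcongr

end Spectral

section Combinatorics

theorem not_dominated_pair {a u v D : ℤ} (ha : 0 < a) (hu : 0 ≤ u) (hv : u + 10 * a ≤ v)
    (h1 : |u ^ 2 - D| ≤ a * max a u) (h2 : |v ^ 2 - D| ≤ a * max a v) : False := by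
  have m1 : max a u ≤ a + u := max_le (by omega) (by omega)
  have m2 : max a v ≤ a + v := max_le (by omega) (by omega)
  have e1 := (abs_le.1 h1).1
  have e2 := (abs_le.1 h2).2
  nlinarith [mul_le_mul_of_nonneg_left m1 ha.le, mul_le_mul_of_nonneg_left m2 ha.le,
    mul_le_mul_of_nonneg_right hv (by omega : 0 ≤ u + v), mul_pos ha ha]

/-- Three well-spaced points on the orbit of an integral binary quadratic form under the
unipotent substitution cannot all have a dominated constant coefficient. -/
theorem binaryForm_eq_zero_of_dominated {d e : ℤ} (hd : 10 ≤ d) (he : d + 10 ≤ e) (a b c : ℤ)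
    (h0 : |c| ≤ max |a| |b|) (h1 : |d ^ 2 * a + 2 * d * b + c| ≤ max |a| |d * a + b|)
    (h2 : |e ^ 2 * a + 2 * e * b + c| ≤ max |a| |e * a + b|) : a = 0 ∧ b = 0 ∧ c = 0 := by
  wlog ha : 0 ≤ a generalizing a b c
  · have := this (-a) (-b) (-c) (by simpa using h0)
      (by rw [← abs_neg] at h1; convert h1 using 2 <;> [ring; simp; skip]
          rw [← abs_neg]; ring_nf)
      (by rw [← abs_neg] at h2; convert h2 using 2 <;> [ring; simp; skip]
          rw [← abs_neg]; ring_nf) (by omega)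
    omega
  rcases ha.eq_or_lt with rfl | ha
  · simp only [mul_zero, zero_add, abs_zero, abs_nonneg, sup_of_le_right] at h0 h1
    have hb : b = 0 := by
      by_contra hb
      have h3 : |2 * d * b| ≤ 2 * |b| := by
        have := abs_sub (2 * d * b + c) c
        rw [add_sub_cancel_right] at this
        omega
      rw [abs_mul, abs_of_nonneg (by omega : 0 ≤ 2 * d)] at h3
      nlinarith [abs_pos.2 hb]
    subst hb
    simpa using h0
  · exfalso
    rw [abs_of_pos ha] at h0 h1 h2
    have key : ∀ t : ℤ, |t ^ 2 * a + 2 * t * b + c| ≤ max a |t * a + b| →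
        ∀ u, u = |t * a + b| → |u ^ 2 - (b ^ 2 - a * c)| ≤ a * max a u := by
      rintro t ht _ rfl
      rw [sq_abs]
      calc |(t * a + b) ^ 2 - (b ^ 2 - a * c)| = a * |t ^ 2 * a + 2 * t * b + c| := by
            rw [← abs_of_pos ha, ← abs_mul, abs_of_pos ha]; ring_nf
        _ ≤ _ := mul_le_mul_of_nonneg_left ht ha.le
    by_cases hs : 0 ≤ d * a + b
    · refine not_dominated_pair ha hs (v := e * a + b) (by nlinarith)
        (key d h1 _ (abs_of_nonneg hs).symm) (key e h2 _ (abs_of_nonneg ?_).symm)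
      nlinarith
    · push Not at hs
      have hb : b < 0 := by nlinarith
      refine not_dominated_pair ha (u := -(d * a + b)) (v := -b) (by omega) (by nlinarith)
        (key d h1 _ (abs_of_neg hs).symm) (key 0 (by simpa using h0) _ ?_)
      rw [zero_mul, zero_add, abs_of_neg hb]

theorem ZMod.valMinAbs_eq_of_small {N : ℕ} [NeZero N] {x : ZMod N} {z : ℤ} (hx : x = z)
    (hz : 2 * |z| < N) : x.valMinAbs = z := by
  rw [ZMod.valMinAbs_spec]
  refine ⟨hx, ?_⟩
  rw [Set.mem_Ioc]
  grind

variable {N : ℕ} {X : Type*} (e : Equiv.Perm X) (x₁ x₂ x₃ : X → ZMod N)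

theorem coord_perm_pow (h₁ : ∀ χ, x₁ (e χ) = x₁ χ) (h₂ : ∀ χ, x₂ (e χ) = x₁ χ + x₂ χ)
    (h₃ : ∀ χ, x₃ (e χ) = x₁ χ + 2 * x₂ χ + x₃ χ) (k : ℕ) (χ : X) :
    x₁ ((e ^ k) χ) = x₁ χ ∧ x₂ ((e ^ k) χ) = k * x₁ χ + x₂ χ ∧
      x₃ ((e ^ k) χ) = k ^ 2 * x₁ χ + 2 * k * x₂ χ + x₃ χ := by
  induction k with
  | zero => simp
  | succ k ih =>
    obtain ⟨i1, i2, i3⟩ := ih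
    rw [pow_succ', Equiv.Perm.mul_apply, h₁, h₂, h₃, i1, i2, i3]
    push_cast
    refine ⟨rfl, by ring, by ring⟩

theorem valMinAbs_perm_pow [NeZero N] (h₁ : ∀ χ, x₁ (e χ) = x₁ χ) (h₂ : ∀ χ, x₂ (e χ) = x₁ χ + x₂ χ)
    (h₃ : ∀ χ, x₃ (e χ) = x₁ χ + 2 * x₂ χ + x₃ χ) {k : ℕ} (hk : k ≤ 40) {χ : X}
    (hs₁ : 4000 * |(x₁ χ).valMinAbs| ≤ N) (hs₂ : 4000 * |(x₂ χ).valMinAbs| ≤ N)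
    (hs₃ : 4000 * |(x₃ χ).valMinAbs| ≤ N) :
    (x₁ ((e ^ k) χ)).valMinAbs = (x₁ χ).valMinAbs ∧
      (x₂ ((e ^ k) χ)).valMinAbs = k * (x₁ χ).valMinAbs + (x₂ χ).valMinAbs ∧
      (x₃ ((e ^ k) χ)).valMinAbs =
        k ^ 2 * (x₁ χ).valMinAbs + 2 * k * (x₂ χ).valMinAbs + (x₃ χ).valMinAbs := by
  obtain ⟨i1, i2, i3⟩ := coord_perm_pow e x₁ x₂ x₃ h₁ h₂ h₃ k χ
  have hN : (0 : ℤ) < N := by exact_mod_cast Nat.pos_of_ne_zero (NeZero.ne N)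
  have hk' : (k : ℤ) ≤ 40 := by exact_mod_cast hk
  have hk0 : (0 : ℤ) ≤ k := by positivity
  have hk2 : (k : ℤ) ^ 2 ≤ 1600 := by nlinarith
  refine ⟨by rw [i1], ZMod.valMinAbs_eq_of_small (by rw [i2]; push_cast; simp) ?_,
    ZMod.valMinAbs_eq_of_small (by rw [i3]; push_cast; simp) ?_⟩
  · have := abs_add_le (k * (x₁ χ).valMinAbs) ((x₂ χ).valMinAbs)
    rw [abs_mul, abs_of_nonneg hk0] at this
    nlinarith [abs_nonneg (x₁ χ).valMinAbs]
  · have h1 := abs_add_three (k ^ 2 * (x₁ χ).valMinAbs) (2 * k * (x₂ χ).valMinAbs)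
      ((x₃ χ).valMinAbs)
    rw [abs_mul, abs_mul, abs_of_nonneg (by positivity : (0 : ℤ) ≤ k ^ 2),
      abs_of_nonneg (by positivity : (0 : ℤ) ≤ 2 * k)] at h1
    nlinarith [abs_nonneg (x₁ χ).valMinAbs, abs_nonneg (x₂ χ).valMinAbs]

theorem five_mul_sum_le [NeZero N] [DecidableEq X] (h₁ : ∀ χ, x₁ (e χ) = x₁ χ)
    (h₂ : ∀ χ, x₂ (e χ) = x₁ χ + x₂ χ)
    (h₃ : ∀ χ, x₃ (e χ) = x₁ χ + 2 * x₂ χ + x₃ χ) (μ : X → ℝ) (hμ : ∀ χ, 0 ≤ μ χ) {η : ℝ}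
    (W Y : Finset X) (hη : ∀ k ≤ 40, ∑ χ ∈ W, μ χ ≤ ∑ χ ∈ W, μ ((e ^ k) χ) + η)
    (hs₁ : ∀ χ ∈ W, 4000 * |(x₁ χ).valMinAbs| ≤ N) (hs₂ : ∀ χ ∈ W, 4000 * |(x₂ χ).valMinAbs| ≤ N)
    (hs₃ : ∀ χ ∈ W, 4000 * |(x₃ χ).valMinAbs| ≤ N)
    (h0 : ∀ χ ∈ W, ¬ (x₁ χ = 0 ∧ x₂ χ = 0 ∧ x₃ χ = 0))
    (hdom : ∀ χ ∈ W, |(x₃ χ).valMinAbs| ≤ max |(x₁ χ).valMinAbs| |(x₂ χ).valMinAbs|)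
    (hY : ∀ χ ∈ W, ∀ k : ℕ, (e ^ k) χ ∈ Y) :
    5 * ∑ χ ∈ W, μ χ ≤ 2 * ∑ χ ∈ Y, μ χ + 5 * η := by
  have htriple : ∀ ψ : X, ∀ k₁ k₂ k₃ : ℕ, k₁ ∈ ({0, 10, 20, 30, 40} : Finset ℕ) →
      k₂ ∈ ({0, 10, 20, 30, 40} : Finset ℕ) → k₃ ∈ ({0, 10, 20, 30, 40} : Finset ℕ) →
      k₁ < k₂ → k₂ < k₃ → (e ^ k₁).symm ψ ∈ W → (e ^ k₂).symm ψ ∈ W → (e ^ k₃).symm ψ ∈ W →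
      False := by
    intro ψ k₁ k₂ k₃ hk₁ hk₂ hk₃ h12 h23 m₁ m₂ m₃
    have key : ∀ k, k < k₃ → (e ^ k).symm ψ = (e ^ (k₃ - k)) ((e ^ k₃).symm ψ) := by
      intro k hk
      rw [Equiv.symm_apply_eq, ← Equiv.Perm.mul_apply, ← pow_add, Nat.add_sub_cancel' hk.le,
        Equiv.apply_symm_apply]
    rw [key k₁ (h12.trans h23)] at m₁
    rw [key k₂ h23] at m₂
    set χ := (e ^ k₃).symm ψ
    have hle : ∀ k ∈ ({0, 10, 20, 30, 40} : Finset ℕ), k ≤ 40 := by decide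
    obtain ⟨a1, a2, a3⟩ := valMinAbs_perm_pow e x₁ x₂ x₃ h₁ h₂ h₃
      ((Nat.sub_le k₃ k₁).trans (hle _ hk₃)) (hs₁ _ m₃) (hs₂ _ m₃) (hs₃ _ m₃)
    obtain ⟨b1, b2, b3⟩ := valMinAbs_perm_pow e x₁ x₂ x₃ h₁ h₂ h₃
      ((Nat.sub_le k₃ k₂).trans (hle _ hk₃)) (hs₁ _ m₃) (hs₂ _ m₃) (hs₃ _ m₃)
    have c1 := hdom _ m₁
    have c2 := hdom _ m₂
    rw [a1, a2, a3] at c1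
    rw [b1, b2, b3] at c2
    have : ∀ i ∈ ({0, 10, 20, 30, 40} : Finset ℕ), ∀ j ∈ ({0, 10, 20, 30, 40} : Finset ℕ),
        i < j → 10 ≤ j - i := by decide
    have s12 := this _ hk₁ _ hk₂ h12
    have s23 := this _ hk₂ _ hk₃ h23
    have hz := binaryForm_eq_zero_of_dominated (by omega) (by omega) _ _ _ (hdom _ m₃) c2 c1
    simp only [ZMod.valMinAbs_eq_zero] at hz
    exact h0 _ m₃ hz
  have hcard : ∀ ψ : X, (({0, 10, 20, 30, 40} : Finset ℕ).filter
      fun k => (e ^ k).symm ψ ∈ W).card ≤ 2 := by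
    intro ψ
    by_contra! hcon
    obtain ⟨i, hi, j, hj, k, hk, hij, hik, hjk⟩ := Finset.two_lt_card.1 hcon
    rw [Finset.mem_filter] at hi hj hk
    have H := htriple ψ
    rcases lt_or_gt_of_ne hij with u | u <;> rcases lt_or_gt_of_ne hik with v | v <;>
      rcases lt_or_gt_of_ne hjk with w | w
    · exact H i j k hi.1 hj.1 hk.1 u w hi.2 hj.2 hk.2
    · exact H i k j hi.1 hk.1 hj.1 v w hi.2 hk.2 hj.2
    · omega
    · exact H k i j hk.1 hi.1 hj.1 v u hk.2 hi.2 hj.2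
    · exact H j i k hj.1 hi.1 hk.1 u v hj.2 hi.2 hk.2
    · omega
    · exact H j k i hj.1 hk.1 hi.1 w v hj.2 hk.2 hi.2
    · exact H k j i hk.1 hj.1 hi.1 w u hk.2 hj.2 hi.2
  have hmain : ∑ k ∈ ({0, 10, 20, 30, 40} : Finset ℕ), ∑ χ ∈ W, μ ((e ^ k) χ) ≤
      2 * ∑ χ ∈ Y, μ χ := by
    calc ∑ k ∈ ({0, 10, 20, 30, 40} : Finset ℕ), ∑ χ ∈ W, μ ((e ^ k) χ)
        ≤ ∑ k ∈ ({0, 10, 20, 30, 40} : Finset ℕ),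
            ∑ ψ ∈ Y, if (e ^ k).symm ψ ∈ W then μ ψ else 0 := by
          refine Finset.sum_le_sum fun k _ => ?_
          rw [← Finset.sum_filter]
          refine (Finset.sum_map W (e ^ k).toEmbedding μ).symm.le.trans ?_
          refine Finset.sum_le_sum_of_subset_of_nonneg ?_ fun _ _ _ => hμ _
          intro ψ hψ
          obtain ⟨χ, hχ, rfl⟩ := Finset.mem_map.1 hψ
          simp [hχ, hY χ hχ k]
      _ = ∑ ψ ∈ Y, (({0, 10, 20, 30, 40} : Finset ℕ).filter
            fun k => (e ^ k).symm ψ ∈ W).card * μ ψ := by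
          rw [Finset.sum_comm]
          refine Finset.sum_congr rfl fun ψ _ => ?_
          rw [← Finset.sum_filter, Finset.sum_const, nsmul_eq_mul]
      _ ≤ ∑ ψ ∈ Y, 2 * μ ψ := by
          refine Finset.sum_le_sum fun ψ _ => mul_le_mul_of_nonneg_right ?_ (hμ ψ)
          exact_mod_cast hcard ψ
      _ = 2 * ∑ χ ∈ Y, μ χ := (Finset.mul_sum _ _ _).symm
  have hlow : ∑ k ∈ ({0, 10, 20, 30, 40} : Finset ℕ), (∑ χ ∈ W, μ χ - η) ≤
      ∑ k ∈ ({0, 10, 20, 30, 40} : Finset ℕ), ∑ χ ∈ W, μ ((e ^ k) χ) := by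
    refine Finset.sum_le_sum fun k hk => ?_
    have : ∀ k ∈ ({0, 10, 20, 30, 40} : Finset ℕ), k ≤ 40 := by decide
    linarith [hη k (this k hk)]
  rw [Finset.sum_const, nsmul_eq_mul] at hlow
  have : (({0, 10, 20, 30, 40} : Finset ℕ).card : ℝ) = 5 := by norm_num
  rw [this] at hlow
  linarith

end Combinatorics

section RelativeT

variable {N : ℕ} [NeZero N]

theorem le_norm_addChar_sub_one (ψ : AddChar (ZMod N) ℂ)
    (hψ : (N : ℤ) < 4000 * |(AddChar.zmodAddEquiv.symm ψ).valMinAbs|) :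
    (1 / 1000 : ℝ) ≤ ‖ψ 1 - 1‖ := by
  have hN : (0 : ℝ) < N := by exact_mod_cast Nat.pos_of_ne_zero (NeZero.ne N)
  obtain ⟨x, rfl⟩ := AddChar.zmodAddEquiv.surjective ψ
  rw [AddEquiv.symm_apply_apply] at hψ
  have hx := ZMod.coe_valMinAbs x
  have hmem := ZMod.valMinAbs_mem_Ioc x
  set z := x.valMinAbs
  rw [Set.mem_Ioc] at hmem
  have hz2 : 2 * |(z : ℝ)| ≤ N := by
    have : 2 * |z| ≤ (N : ℤ) := by grind
    exact_mod_cast this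
  have hz1 : (N : ℝ) < 4000 * |(z : ℝ)| := by exact_mod_cast hψ
  have h1 : AddChar.zmodAddEquiv x (1 : ZMod N) =
      Complex.exp (Complex.I * ((2 * Real.pi * (z / N) : ℝ) : ℂ)) := by
    have h : AddChar.zmodAddEquiv x (1 : ZMod N) = (AddChar.zmod N x 1 : Circle) := rfl
    have := AddChar.zmod_intCast N z 1
    rw [Int.cast_one, hx] at this
    rw [h, this, Circle.coe_exp]
    push_cast
    congr 1
    ring
  have h2 : 2 * Real.pi * (z / N : ℝ) / 2 = Real.pi * (z / N) := by ring
  have h3 : |Real.pi * (z / N : ℝ)| = Real.pi * (|(z : ℝ)| / N) := by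
    rw [abs_mul, abs_div, abs_of_pos Real.pi_pos, abs_of_pos hN]
  have h4 : |(z : ℝ)| / N ≤ 1 / 2 := by rw [div_le_iff₀ hN]; linarith
  have h5 : (1 / 4000 : ℝ) ≤ |(z : ℝ)| / N := by rw [le_div_iff₀ hN]; linarith
  have hpi := Real.pi_pos
  rw [h1, Complex.norm_exp_I_mul_ofReal_sub_one, norm_mul, Real.norm_eq_abs, Real.norm_eq_abs,
    abs_of_pos (by norm_num : (0 : ℝ) < 2), h2, Real.abs_sin_eq_sin_abs_of_abs_le_pi
      (by rw [h3]; nlinarith), h3]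
  have h6 := Real.mul_le_sin (x := Real.pi * (|(z : ℝ)| / N)) (by positivity) (by nlinarith)
  rw [← mul_assoc, div_mul_cancel₀ _ hpi.ne'] at h6
  linarith

/-- The coordinate of a character along a cyclic subgroup. -/
noncomputable def charCoord {A : Type*} [AddCommGroup A] (i : ZMod N →+ A)
    (χ : AddChar A ℂ) : ZMod N :=
  AddChar.zmodAddEquiv.symm (χ.compAddMonoidHom i)

theorem charCoord_add {A : Type*} [AddCommGroup A] (i j : ZMod N →+ A)
    (χ : AddChar A ℂ) : charCoord (i + j) χ = charCoord i χ + charCoord j χ := by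
  unfold charCoord
  rw [← map_add]
  congr 1
  ext x
  simp [AddChar.map_add_eq_mul]

theorem apply_eq_one_of_charCoord_eq_zero {A : Type*} [AddCommGroup A] {i : ZMod N →+ A}
    {χ : AddChar A ℂ} (h : charCoord i χ = 0) (x : ZMod N) : χ (i x) = 1 := by
  unfold charCoord at h
  rw [map_eq_zero_iff _ AddChar.zmodAddEquiv.symm.injective] at h
  have := DFunLike.congr_fun h x
  simpa using this

/-- Composition with an automorphism, as a permutation of the characters. -/
noncomputable def charPerm {A : Type*} [AddCommGroup A] (τ : A ≃+ A) :
    Equiv.Perm (AddChar A ℂ) where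
  toFun χ := χ.compAddMonoidHom τ.toAddMonoidHom
  invFun χ := χ.compAddMonoidHom τ.symm.toAddMonoidHom
  left_inv χ := by ext; simp
  right_inv χ := by ext; simp

theorem charCoord_charPerm {A : Type*} [AddCommGroup A] (τ : A ≃+ A) (i : ZMod N →+ A)
    (χ : AddChar A ℂ) : charCoord i (charPerm τ χ) = charCoord (τ.toAddMonoidHom.comp i) χ := rfl

theorem norm_specProj_charPerm_pow {A : Type*} [AddCommGroup A] [Fintype A] {V : Type*}
    [NormedAddCommGroup V] [InnerProductSpace ℂ V] (n : Multiplicative A →* (V ≃ₗᵢ[ℂ] V))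
    (m : V ≃ₗᵢ[ℂ] V) (τ : A ≃+ A) (hm : ∀ a v, m (n (Multiplicative.ofAdd a) v) =
      n (Multiplicative.ofAdd (τ a)) (m v)) (k : ℕ) (χ : AddChar A ℂ) (v : V) :
    ‖specProj n ((charPerm τ ^ k) χ) v‖ = ‖specProj n χ ((m ^ k) v)‖ := by
  induction k generalizing χ v with
  | zero => simp
  | succ k ih =>
    have : (m ^ (k + 1)) v = m ((m ^ k) v) := by rw [pow_succ']; rfl
    rw [pow_succ, Equiv.Perm.mul_apply, ih, this, specProj_intertwine n m τ hm,
      LinearIsometryEquiv.norm_map]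
    rfl

theorem five_mul_specMass_le {A : Type*} [AddCommGroup A] [Fintype A] {V : Type*}
    [NormedAddCommGroup V] [InnerProductSpace ℂ V] [DecidableEq (AddChar A ℂ)]
    (n : Multiplicative A →* (V ≃ₗᵢ[ℂ] V))
    (m : V ≃ₗᵢ[ℂ] V) (τ : A ≃+ A) (hm : ∀ a v, m (n (Multiplicative.ofAdd a) v) =
      n (Multiplicative.ofAdd (τ a)) (m v)) (i₁ i₂ i₃ : ZMod N →+ A)
    (h₁ : τ.toAddMonoidHom.comp i₁ = i₁) (h₂ : τ.toAddMonoidHom.comp i₂ = i₁ + i₂)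
    (h₃ : τ.toAddMonoidHom.comp i₃ = i₁ + (i₂ + i₂) + i₃) {v : V} {ε : ℝ}
    (hv : ‖m v - v‖ ≤ ε * ‖v‖) (W : Finset (AddChar A ℂ))
    (hs₁ : ∀ χ ∈ W, 4000 * |(charCoord i₁ χ).valMinAbs| ≤ N)
    (hs₂ : ∀ χ ∈ W, 4000 * |(charCoord i₂ χ).valMinAbs| ≤ N)
    (hs₃ : ∀ χ ∈ W, 4000 * |(charCoord i₃ χ).valMinAbs| ≤ N)
    (h0 : ∀ χ ∈ W, ¬ (charCoord i₁ χ = 0 ∧ charCoord i₂ χ = 0 ∧ charCoord i₃ χ = 0))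
    (hdom : ∀ χ ∈ W, |(charCoord i₃ χ).valMinAbs| ≤
      max |(charCoord i₁ χ).valMinAbs| |(charCoord i₂ χ).valMinAbs|) :
    5 * specMass n v W ≤ 2 * specMass n v (Finset.univ.erase 0) + 400 * ε * ‖v‖ ^ 2 := by
  have c₁ : ∀ χ, charCoord i₁ (charPerm τ χ) = charCoord i₁ χ := fun χ => by
    rw [charCoord_charPerm, h₁]
  have c₂ : ∀ χ, charCoord i₂ (charPerm τ χ) = charCoord i₁ χ + charCoord i₂ χ := fun χ => by
    rw [charCoord_charPerm, h₂, charCoord_add]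
  have c₃ : ∀ χ, charCoord i₃ (charPerm τ χ) =
      charCoord i₁ χ + 2 * charCoord i₂ χ + charCoord i₃ χ := fun χ => by
    rw [charCoord_charPerm, h₃, charCoord_add, charCoord_add, charCoord_add]; ring
  have := five_mul_sum_le (charPerm τ) (charCoord i₁) (charCoord i₂) (charCoord i₃) c₁ c₂ c₃
    (fun χ => ‖specProj n χ v‖ ^ 2) (fun χ => by positivity) (η := 80 * ε * ‖v‖ ^ 2) W
    (Finset.univ.erase 0) ?_ hs₁ hs₂ hs₃ h0 hdom ?_
  · unfold specMass
    linarith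
  · intro k hk
    simp_rw [norm_specProj_charPerm_pow n m τ hm]
    refine (specMass_le_add_norm_sub n v ((m ^ k) v) W).trans ?_
    refine add_le_add le_rfl ?_
    rw [LinearIsometryEquiv.norm_map]
    have hk' : (k : ℝ) ≤ 40 := by exact_mod_cast hk
    have h1 : ‖(m ^ k) v - v‖ ≤ k * ‖m v - v‖ :=
      norm_map_pow_sub_le (MonoidHom.id (V ≃ₗᵢ[ℂ] V)) v m k
    have h2 : ‖(m ^ k) v - v‖ ≤ 40 * (ε * ‖v‖) :=
      h1.trans (mul_le_mul hk' hv (norm_nonneg _) (by norm_num))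
    nlinarith [norm_nonneg v]
  · intro χ hχ k
    rw [Finset.mem_erase]
    refine ⟨fun h => h0 χ hχ ?_, Finset.mem_univ _⟩
    obtain ⟨e1, e2, e3⟩ := coord_perm_pow (charPerm τ) (charCoord i₁) (charCoord i₂)
      (charCoord i₃) c₁ c₂ c₃ k χ
    have hz : ∀ i : ZMod N →+ A, charCoord i (0 : AddChar A ℂ) = 0 := fun i => by
      unfold charCoord
      rw [map_eq_zero_iff _ AddChar.zmodAddEquiv.symm.injective]
      rfl
    rw [h, hz] at e1 e2 e3
    rw [← e1] at e2 e3 ⊢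
    simp only [mul_zero, zero_add] at e2 e3
    rw [← e2] at e3 ⊢
    simp only [mul_zero, zero_add] at e3
    exact ⟨rfl, rfl, e3.symm⟩

/-- Relative property (T), with an explicit constant, for the action on binary quadratic forms
modulo `N`. -/
theorem norm_map_sub_sq_le_of_binaryForm {A : Type*} [AddCommGroup A] [Fintype A] {V : Type*}
    [NormedAddCommGroup V] [InnerProductSpace ℂ V]
    (n : Multiplicative A →* (V ≃ₗᵢ[ℂ] V))
    (m m' : V ≃ₗᵢ[ℂ] V) (τ τ' : A ≃+ A) (hm : ∀ a v, m (n (Multiplicative.ofAdd a) v) =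
      n (Multiplicative.ofAdd (τ a)) (m v))
    (hm' : ∀ a v, m' (n (Multiplicative.ofAdd a) v) = n (Multiplicative.ofAdd (τ' a)) (m' v))
    (i₁ i₂ i₃ : ZMod N →+ A) (hi : ∀ a, ∃ x y z, a = i₁ x + i₂ y + i₃ z)
    (h₁ : τ.toAddMonoidHom.comp i₁ = i₁) (h₂ : τ.toAddMonoidHom.comp i₂ = i₁ + i₂)
    (h₃ : τ.toAddMonoidHom.comp i₃ = i₁ + (i₂ + i₂) + i₃)
    (h₃' : τ'.toAddMonoidHom.comp i₃ = i₃) (h₂' : τ'.toAddMonoidHom.comp i₂ = i₃ + i₂)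
    (h₁' : τ'.toAddMonoidHom.comp i₁ = i₃ + (i₂ + i₂) + i₁) {v : V} {ε : ℝ} (hε : 0 ≤ ε)
    (hε1 : ε ≤ 1) (hv : ‖m v - v‖ ≤ ε * ‖v‖) (hv' : ‖m' v - v‖ ≤ ε * ‖v‖)
    (hv₁ : ‖n (Multiplicative.ofAdd (i₁ 1)) v - v‖ ≤ ε * ‖v‖)
    (hv₂ : ‖n (Multiplicative.ofAdd (i₂ 1)) v - v‖ ≤ ε * ‖v‖)
    (hv₃ : ‖n (Multiplicative.ofAdd (i₃ 1)) v - v‖ ≤ ε * ‖v‖) (a : A) :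
    ‖n (Multiplicative.ofAdd a) v - v‖ ^ 2 ≤ 10 ^ 8 * ε * ‖v‖ ^ 2 := by
  classical
  have htail : ∀ i : ZMod N →+ A, ‖n (Multiplicative.ofAdd (i 1)) v - v‖ ≤ ε * ‖v‖ →
      specMass n v (Finset.univ.filter fun χ => (N : ℤ) < 4000 * |(charCoord i χ).valMinAbs|) ≤
        10 ^ 6 * ε * ‖v‖ ^ 2 := by
    intro i hi
    have := specMass_le_of_norm_sub_one n (i 1) v
      (Finset.univ.filter fun χ => (N : ℤ) < 4000 * |(charCoord i χ).valMinAbs|)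
      (c := 1 / 1000) (by norm_num) fun χ hχ =>
        le_norm_addChar_sub_one _ (Finset.mem_filter.1 hχ).2
    have h2 : ‖n (Multiplicative.ofAdd (i 1)) v - v‖ ^ 2 ≤ ε * ‖v‖ ^ 2 := by
      have := pow_le_pow_left₀ (norm_nonneg _) hi 2
      nlinarith [mul_le_mul_of_nonneg_right (mul_le_of_le_one_right hε hε1) (sq_nonneg ‖v‖)]
    linarith
  have t₁ := htail i₁ hv₁
  have t₂ := htail i₂ hv₂
  have t₃ := htail i₃ hv₃
  set small : AddChar A ℂ → Prop := fun χ => 4000 * |(charCoord i₁ χ).valMinAbs| ≤ N ∧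
    4000 * |(charCoord i₂ χ).valMinAbs| ≤ N ∧ 4000 * |(charCoord i₃ χ).valMinAbs| ≤ N ∧
    ¬ (charCoord i₁ χ = 0 ∧ charCoord i₂ χ = 0 ∧ charCoord i₃ χ = 0) with hsmall
  set W := Finset.univ.filter fun χ => small χ ∧ |(charCoord i₃ χ).valMinAbs| ≤
      max |(charCoord i₁ χ).valMinAbs| |(charCoord i₂ χ).valMinAbs| with hW
  set W' := Finset.univ.filter fun χ => small χ ∧ |(charCoord i₁ χ).valMinAbs| ≤
      max |(charCoord i₃ χ).valMinAbs| |(charCoord i₂ χ).valMinAbs| with hW'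
  have mW := five_mul_specMass_le n m τ hm i₁ i₂ i₃ h₁ h₂ h₃ hv W (by grind) (by grind)
    (by grind) (by grind) (by grind)
  have mW' := five_mul_specMass_le n m' τ' hm' i₃ i₂ i₁ h₃' h₂' h₁' hv' W' (by grind) (by grind)
    (by grind) (by grind) (by grind)
  have hcover : specMass n v (Finset.univ.erase 0) ≤ specMass n v W + specMass n v W' +
      specMass n v (Finset.univ.filter fun χ => (N : ℤ) < 4000 * |(charCoord i₁ χ).valMinAbs|) +
      specMass n v (Finset.univ.filter fun χ => (N : ℤ) < 4000 * |(charCoord i₂ χ).valMinAbs|) +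
      specMass n v (Finset.univ.filter fun χ => (N : ℤ) < 4000 * |(charCoord i₃ χ).valMinAbs|) := by
    have hunion : ∀ B B', specMass n v (B ∪ B') ≤ specMass n v B + specMass n v B' := by
      intro B B'
      have h := Finset.sum_union_inter (s₁ := B) (s₂ := B') (f := fun χ => ‖specProj n χ v‖ ^ 2)
      have h0 := specMass_nonneg n v (B ∩ B')
      unfold specMass at h0 ⊢
      linarith
    refine (specMass_mono n v ?_).trans ((hunion _ _).trans (add_le_add ((hunion _ _).trans
      (add_le_add ((hunion _ _).trans (add_le_add (hunion _ _) le_rfl)) le_rfl)) le_rfl))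
    intro χ hχ
    have hne : ¬ (charCoord i₁ χ = 0 ∧ charCoord i₂ χ = 0 ∧ charCoord i₃ χ = 0) := by
      rintro ⟨z₁, z₂, z₃⟩
      refine (Finset.mem_erase.1 hχ).1 (DFunLike.ext _ _ fun a => ?_)
      obtain ⟨x, y, z, rfl⟩ := hi a
      rw [AddChar.map_add_eq_mul, AddChar.map_add_eq_mul, apply_eq_one_of_charCoord_eq_zero z₁,
        apply_eq_one_of_charCoord_eq_zero z₂, apply_eq_one_of_charCoord_eq_zero z₃]
      simp
    simp only [Finset.mem_union, hW, hW', hsmall, Finset.mem_filter, Finset.mem_univ, true_and,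
      le_max_iff]
    by_cases q₁ : (N : ℤ) < 4000 * |(charCoord i₁ χ).valMinAbs|
    · exact Or.inl (Or.inl (Or.inr q₁))
    by_cases q₂ : (N : ℤ) < 4000 * |(charCoord i₂ χ).valMinAbs|
    · exact Or.inl (Or.inr q₂)
    by_cases q₃ : (N : ℤ) < 4000 * |(charCoord i₃ χ).valMinAbs|
    · exact Or.inr q₃
    rw [not_lt] at q₁ q₂ q₃
    left; left; left
    rcases le_total |(charCoord i₃ χ).valMinAbs| |(charCoord i₁ χ).valMinAbs| with h | h
    · exact Or.inl ⟨⟨q₁, q₂, q₃, hne⟩, Or.inl h⟩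
    · exact Or.inr ⟨⟨q₁, q₂, q₃, hne⟩, Or.inl h⟩
  have hfin := norm_map_sub_sq_le_specMass n a v
  nlinarith [mul_nonneg hε (sq_nonneg ‖v‖)]

end RelativeT

section Transvections

open Matrix

variable {l R : Type*} [DecidableEq l] [Fintype l] [CommRing R]

/-- The standard symplectic form. -/
def sympForm (x y : l ⊕ l → R) : R := x ⬝ᵥ (J l R *ᵥ y)

theorem sympForm_eq (x y : l ⊕ l → R) :
    sympForm x y = ∑ i, (x (Sum.inr i) * y (Sum.inl i) - x (Sum.inl i) * y (Sum.inr i)) := by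
  have h : J l R *ᵥ y = Sum.elim (fun i => - y (Sum.inr i)) (fun i => y (Sum.inl i)) := by
    rw [J, fromBlocks_mulVec]
    ext (i | i) <;> simp [neg_mulVec]
  rw [sympForm, h, dotProduct, Fintype.sum_sum_type, ← Finset.sum_add_distrib]
  exact Finset.sum_congr rfl fun i _ => by simp; ring

theorem sympForm_self (x : l ⊕ l → R) : sympForm x x = 0 := by
  rw [sympForm_eq]
  exact Finset.sum_eq_zero fun i _ => by ring

theorem sympForm_swap (x y : l ⊕ l → R) : sympForm x y = - sympForm y x := by
  rw [sympForm_eq, sympForm_eq, ← Finset.sum_neg_distrib]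
  exact Finset.sum_congr rfl fun i _ => by ring

theorem sympForm_add_left (x y z : l ⊕ l → R) :
    sympForm (x + y) z = sympForm x z + sympForm y z := add_dotProduct _ _ _

theorem sympForm_sub_left (x y z : l ⊕ l → R) :
    sympForm (x - y) z = sympForm x z - sympForm y z := sub_dotProduct _ _ _

theorem sympForm_smul_left (c : R) (x z : l ⊕ l → R) :
    sympForm (c • x) z = c * sympForm x z := smul_dotProduct _ _ _

theorem sympForm_add_right (x y z : l ⊕ l → R) :
    sympForm z (x + y) = sympForm z x + sympForm z y := by
  rw [sympForm, mulVec_add, dotProduct_add]; rfl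

theorem sympForm_smul_right (c : R) (x z : l ⊕ l → R) :
    sympForm z (c • x) = c * sympForm z x := by
  rw [sympForm, mulVec_smul, dotProduct_smul]; rfl

theorem exists_sympForm_ne_zero {v : l ⊕ l → R} (hv : v ≠ 0) : ∃ x, sympForm v x ≠ 0 := by
  by_contra! h
  apply hv
  ext (i | i)
  · have := h (Pi.single (Sum.inr i) 1)
    rw [sympForm_eq] at this
    simpa [Pi.single_apply] using this
  · have := h (Pi.single (Sum.inl i) 1)
    rw [sympForm_eq] at this
    simpa [Pi.single_apply] using this

theorem mem_symplecticGroup_iff_sympForm {A : Matrix (l ⊕ l) (l ⊕ l) R} :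
    A ∈ symplecticGroup l R ↔ ∀ x y, sympForm (A *ᵥ x) (A *ᵥ y) = sympForm x y := by
  have key : ∀ x y, sympForm (A *ᵥ x) (A *ᵥ y) = x ⬝ᵥ ((Aᵀ * J l R * A) *ᵥ y) := fun x y => by
    rw [sympForm, ← vecMul_transpose, ← dotProduct_mulVec, mulVec_mulVec, mulVec_mulVec,
      Matrix.mul_assoc]
  rw [SymplecticGroup.mem_iff']
  refine ⟨fun h x y => by rw [key, h]; rfl, fun h => ?_⟩
  ext i j
  have := h (Pi.single i 1) (Pi.single j 1)
  rw [key] at this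
  simpa [sympForm] using this

theorem sympForm_mulVec (A : symplecticGroup l R) (x y : l ⊕ l → R) :
    sympForm (A.1 *ᵥ x) (A.1 *ᵥ y) = sympForm x y :=
  mem_symplecticGroup_iff_sympForm.1 A.2 x y

/-- The symplectic transvection `x ↦ x + t ω(v, x) v`. -/
def sympTransvection (v : l ⊕ l → R) (t : R) : symplecticGroup l R :=
  ⟨1 + t • vecMulVec v (v ᵥ* J l R), by
    have : ∀ x, (1 + t • vecMulVec v (v ᵥ* J l R)) *ᵥ x = x + (t * sympForm v x) • v := fun x => by
      rw [add_mulVec, one_mulVec, smul_mulVec, vecMulVec_mulVec, ← dotProduct_mulVec, sympForm,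
        mul_smul, op_smul_eq_smul]
    rw [mem_symplecticGroup_iff_sympForm]
    intro x y
    simp only [this, sympForm_add_left, sympForm_add_right, sympForm_smul_left,
      sympForm_smul_right, sympForm_self]
    rw [sympForm_swap x v]
    ring⟩

theorem sympTransvection_mulVec (v : l ⊕ l → R) (t : R) (x : l ⊕ l → R) :
    (sympTransvection v t).1 *ᵥ x = x + (t * sympForm v x) • v := by
  rw [sympTransvection, add_mulVec, one_mulVec, smul_mulVec, vecMulVec_mulVec, ← dotProduct_mulVec,
    sympForm, mul_smul, op_smul_eq_smul]

theorem symplecticGroup_ext {A B : symplecticGroup l R} (h : ∀ x, A.1 *ᵥ x = B.1 *ᵥ x) : A = B :=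
  Subtype.ext (Matrix.mulVec_injective (funext h))

theorem symplecticGroup_mul_mulVec (A B : symplecticGroup l R) (x : l ⊕ l → R) :
    (A * B).1 *ᵥ x = A.1 *ᵥ (B.1 *ᵥ x) := (mulVec_mulVec _ _ _).symm

theorem sympTransvection_inv (v : l ⊕ l → R) (t : R) :
    (sympTransvection v t)⁻¹ = sympTransvection v (-t) := by
  rw [inv_eq_iff_mul_eq_one]
  refine symplecticGroup_ext fun x => ?_
  rw [symplecticGroup_mul_mulVec, sympTransvection_mulVec, sympTransvection_mulVec,
    sympForm_add_right, sympForm_smul_right, sympForm_self]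
  change _ = (1 : Matrix (l ⊕ l) (l ⊕ l) R) *ᵥ x
  rw [one_mulVec, mul_zero, add_zero, neg_mul, neg_smul]
  abel

theorem conj_sympTransvection (A : symplecticGroup l R) (v : l ⊕ l → R) (t : R) :
    A * sympTransvection v t * A⁻¹ = sympTransvection (A.1 *ᵥ v) t := by
  rw [mul_inv_eq_iff_eq_mul]
  refine symplecticGroup_ext fun x => ?_
  rw [symplecticGroup_mul_mulVec, symplecticGroup_mul_mulVec, sympTransvection_mulVec,
    sympTransvection_mulVec, sympForm_mulVec, mulVec_add, mulVec_smul]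

end Transvections

section BoundedGeneration

open Matrix Pointwise

variable {l F : Type*} [DecidableEq l] [Fintype l] [Field F]

/-- The fixed space of a symplectic matrix. -/
def fixSpace (A : symplecticGroup l F) : Submodule F (l ⊕ l → F) where
  carrier := {x | A.1 *ᵥ x = x}
  add_mem' := fun {x y} hx hy => by
    simp only [Set.mem_ofPred_eq] at *
    rw [mulVec_add, hx, hy]
  zero_mem' := mulVec_zero _
  smul_mem' := fun c x hx => by
    simp only [Set.mem_ofPred_eq] at *
    rw [mulVec_smul, hx]

theorem mem_fixSpace {A : symplecticGroup l F} {x : l ⊕ l → F} :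
    x ∈ fixSpace A ↔ A.1 *ᵥ x = x := Iff.rfl

theorem sympForm_sub_eq_zero_of_mem_fixSpace {A : symplecticGroup l F} {y : l ⊕ l → F}
    (hy : y ∈ fixSpace A) (x : l ⊕ l → F) : sympForm (A.1 *ᵥ x - x) y = 0 := by
  nth_rw 1 [sympForm_sub_left, ← mem_fixSpace.1 hy]
  rw [sympForm_mulVec, sub_self]

theorem fixSpace_lt_of_sympForm_ne_zero (A : symplecticGroup l F) (x : l ⊕ l → F)
    (hx : sympForm (A.1 *ᵥ x) x ≠ 0) :
    ∃ v t, fixSpace A < fixSpace (sympTransvection v t * A) := by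
  refine ⟨A.1 *ᵥ x - x, -(sympForm (A.1 *ᵥ x) x)⁻¹, ?_⟩
  have hx' : A.1 *ᵥ x ≠ x := fun h => hx (by rw [h, sympForm_self])
  refine SetLike.lt_iff_le_and_exists.2 ⟨fun y hy => ?_, x, ?_, hx'⟩
  · rw [mem_fixSpace, symplecticGroup_mul_mulVec, mem_fixSpace.1 hy, sympTransvection_mulVec,
      sympForm_sub_eq_zero_of_mem_fixSpace hy]
    simp
  · rw [mem_fixSpace, symplecticGroup_mul_mulVec, sympTransvection_mulVec, sympForm_sub_left,
      sympForm_self, sympForm_swap x, zero_sub, neg_neg, neg_mul, inv_mul_cancel₀ hx]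
    simp

theorem exists_sympTransvection_lt_fixSpace (A : symplecticGroup l F) (hA : A ≠ 1) :
    ∃ v t w s, fixSpace A < fixSpace (sympTransvection v t * (sympTransvection w s * A)) := by
  by_cases h : ∃ x, sympForm (A.1 *ᵥ x) x ≠ 0
  · obtain ⟨x, hx⟩ := h
    obtain ⟨v, t, h⟩ := fixSpace_lt_of_sympForm_ne_zero A x hx
    refine ⟨v, t, 0, 0, ?_⟩
    have : sympTransvection (0 : l ⊕ l → F) 0 = 1 := Subtype.ext (by simp [sympTransvection])
    rwa [this, one_mul]
  push Not at h
  obtain ⟨y, hy⟩ : ∃ y, A.1 *ᵥ y ≠ y := by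
    by_contra! hcon
    exact hA (symplecticGroup_ext fun x => (hcon x).trans (one_mulVec x).symm)
  set v := A.1 *ᵥ y - y with hv
  have hv0 : v ≠ 0 := sub_ne_zero.2 hy
  obtain ⟨x₁, h₁⟩ := exists_sympForm_ne_zero hv0
  obtain ⟨x₂, h₂⟩ : ∃ x, sympForm v (A.1 *ᵥ x) ≠ 0 := by
    refine ⟨A⁻¹.1 *ᵥ x₁, ?_⟩
    rw [← symplecticGroup_mul_mulVec, mul_inv_cancel]
    exact (one_mulVec x₁).symm ▸ h₁
  obtain ⟨x, hx₁, hx₂⟩ : ∃ x, sympForm v x ≠ 0 ∧ sympForm v (A.1 *ᵥ x) ≠ 0 := by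
    by_cases c₁ : sympForm v (A.1 *ᵥ x₁) = 0
    · by_cases c₂ : sympForm v x₂ = 0
      · refine ⟨x₁ + x₂, ?_, ?_⟩
        · rwa [sympForm_add_right, c₂, add_zero]
        · rwa [mulVec_add, sympForm_add_right, c₁, zero_add]
      · exact ⟨x₂, c₂, h₂⟩
    · exact ⟨x₁, h₁, c₁⟩
  obtain ⟨w, s, hlt⟩ := fixSpace_lt_of_sympForm_ne_zero (sympTransvection v 1 * A) x (by
    rw [symplecticGroup_mul_mulVec, sympTransvection_mulVec, sympForm_add_left, h,
      sympForm_smul_left, zero_add, one_mul]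
    exact mul_ne_zero hx₂ hx₁)
  refine ⟨w, s, v, 1, lt_of_le_of_lt (fun z hz => ?_) hlt⟩
  rw [mem_fixSpace, symplecticGroup_mul_mulVec, mem_fixSpace.1 hz, sympTransvection_mulVec,
    sympForm_sub_eq_zero_of_mem_fixSpace hz]
  simp

theorem mem_sympTransvection_pow (A : symplecticGroup l F) :
    A ∈ (Set.range fun p : (l ⊕ l → F) × F => sympTransvection p.1 p.2) ^
      (2 * (2 * Fintype.card l)) := by
  set E := Set.range fun p : (l ⊕ l → F) × F => sympTransvection p.1 p.2
  have h1 : (1 : symplecticGroup l F) ∈ E :=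
    ⟨(0, 0), Subtype.ext (by simp [sympTransvection])⟩
  have hmem : ∀ v t, (sympTransvection v t)⁻¹ ∈ E := fun v t =>
    ⟨(v, -t), (sympTransvection_inv v t).symm⟩
  have key : ∀ r : ℕ, ∀ A : symplecticGroup l F,
      2 * Fintype.card l ≤ Module.finrank F (fixSpace A) + r → A ∈ E ^ (2 * r) := by
    intro r
    induction r with
    | zero =>
      intro A hA
      have : fixSpace A = ⊤ := by
        apply Submodule.eq_top_of_finrank_eq
        refine le_antisymm (Submodule.finrank_le _) ?_
        rw [Module.finrank_fintype_fun_eq_card, Fintype.card_sum]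
        omega
      have : A = 1 := symplecticGroup_ext fun x => by
        have hx : x ∈ fixSpace A := this ▸ Submodule.mem_top
        exact hx.trans (one_mulVec x).symm
      simp [this]
    | succ r ih =>
      intro A hA
      by_cases hA1 : A = 1
      · rw [hA1]
        exact Set.one_mem_pow h1
      obtain ⟨v, t, w, s, hlt⟩ := exists_sympTransvection_lt_fixSpace A hA1
      have hr := Submodule.finrank_lt_finrank_of_lt hlt
      have := ih (sympTransvection v t * (sympTransvection w s * A)) (by omega)
      have e : A = (sympTransvection w s)⁻¹ * ((sympTransvection v t)⁻¹ *
          (sympTransvection v t * (sympTransvection w s * A))) := by group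
      rw [e, show 2 * (r + 1) = 2 * r + 1 + 1 by ring, pow_succ', pow_succ']
      exact Set.mul_mem_mul (hmem _ _) (Set.mul_mem_mul (hmem _ _) this)
  exact key _ A (by omega)

end BoundedGeneration

section Siegel

open Matrix Pointwise

variable {l R : Type*} [DecidableEq l] [Fintype l] [CommRing R]

/-- The upper unipotent symplectic matrix with off-diagonal block `B + Bᵀ`. -/
def siegel : Multiplicative (Matrix l l R) →* symplecticGroup l R where
  toFun B := ⟨fromBlocks 1 (B.toAdd + B.toAddᵀ) 0 1, by
    rw [SymplecticGroup.fromBlocks_mem_iff]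
    simp [add_comm]⟩
  map_one' := by
    apply Subtype.ext
    simp
  map_mul' B C := by
    apply Subtype.ext
    simp only [toAdd_mul, transpose_add, Submonoid.coe_mul, fromBlocks_multiply]
    congr 1 <;> simp
    abel

theorem coe_siegel (B : Matrix l l R) :
    (siegel (Multiplicative.ofAdd B)).1 = fromBlocks 1 (B + Bᵀ) 0 1 := rfl

/-- The lower unipotent symplectic matrix with off-diagonal block `-(B + Bᵀ)`. -/
def siegelLow (B : Matrix l l R) : symplecticGroup l R :=
  SymplecticGroup.symJ l R * siegel (Multiplicative.ofAdd B) * (SymplecticGroup.symJ l R)⁻¹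

theorem coe_siegelLow (B : Matrix l l R) :
    (siegelLow B).1 = fromBlocks 1 0 (-(B + Bᵀ)) 1 := by
  rw [siegelLow, Submonoid.coe_mul, Submonoid.coe_mul, SymplecticGroup.coe_inv', coe_siegel,
    SymplecticGroup.coe_J, Matrix.J_inv]
  simp only [Matrix.J, fromBlocks_multiply, fromBlocks_neg]
  simp

theorem sympTransvection_sumElim_zero {F : Type*} [Field F] (h2 : (2 : F) ≠ 0) (v : l → F)
    (t : F) :
    sympTransvection (Sum.elim v 0) t =
      siegel (Multiplicative.ofAdd ((-(t / 2)) • vecMulVec v v)) := by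
  refine Subtype.ext ?_
  rw [coe_siegel]
  simp only [sympTransvection, Matrix.J]
  ext (i | i) (j | j) <;>
    simp [vecMulVec_apply, vecMul, dotProduct, Fintype.sum_sum_type, Matrix.one_apply]
  · field_simp
    ring

theorem exists_isSymm_mulVec_eq {F : Type*} [Field F] {v : l → F} (hv : v ≠ 0) (w : l → F) :
    ∃ S : Matrix l l F, S.IsSymm ∧ S *ᵥ v = w := by
  obtain ⟨i, hi⟩ : ∃ i, v i ≠ 0 := by
    by_contra! h
    exact hv (funext h)
  set u : l → F := Pi.single i (v i)⁻¹ with hu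
  have huv : u ⬝ᵥ v = 1 := by simp [hu, hi]
  refine ⟨vecMulVec w u + vecMulVec u w - (w ⬝ᵥ v) • vecMulVec u u, ?_, ?_⟩
  · simp [IsSymm, transpose_vecMulVec, add_comm]
  · simp only [sub_mulVec, add_mulVec, smul_mulVec, vecMulVec_mulVec, huv, op_smul_eq_smul,
      one_smul]
    abel

theorem sympTransvection_mem_siegel_pow {F : Type*} [Field F] (h2 : (2 : F) ≠ 0) (v : l ⊕ l → F)
    (t : F) : sympTransvection v t ∈
      (Set.range (siegel (l := l) (R := F)) ∪ Set.range siegelLow) ^ 3 := by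
  have one_mem : (1 : symplecticGroup l F) ∈
      Set.range (siegel (l := l) (R := F)) ∪ Set.range siegelLow := Or.inl ⟨1, map_one _⟩
  obtain ⟨v₁, v₂, rfl⟩ : ∃ v₁ v₂, v = Sum.elim v₁ v₂ :=
    ⟨v ∘ Sum.inl, v ∘ Sum.inr, (Sum.elim_comp_inl_inr v).symm⟩
  rw [pow_succ, pow_succ, pow_one]
  by_cases h1 : v₁ = 0
  · have : sympTransvection (Sum.elim v₁ v₂) t =
        siegelLow ((-(t / 2)) • vecMulVec v₂ v₂) := by
      rw [siegelLow, ← sympTransvection_sumElim_zero h2, conj_sympTransvection,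
        SymplecticGroup.coe_J, Matrix.J, fromBlocks_mulVec, h1]
      simp
    rw [this]
    simpa using Set.mul_mem_mul (Set.mul_mem_mul one_mem one_mem)
      (Or.inr ⟨_, rfl⟩ : siegelLow ((-(t / 2)) • vecMulVec v₂ v₂) ∈ _)
  · obtain ⟨S, hS, hSv⟩ := exists_isSymm_mulVec_eq h1 v₂
    have hB : ((-(1 / 2 : F)) • S) + ((-(1 / 2 : F)) • S)ᵀ = -S := by
      rw [transpose_smul, hS.eq, ← add_smul]
      have : (-(1 / 2 : F)) + -(1 / 2) = -1 := by field_simp; norm_num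
      rw [this, neg_one_smul]
    have hinv : (siegelLow ((-(1 / 2 : F)) • S))⁻¹ = siegelLow (-((-(1 / 2 : F)) • S)) := by
      rw [siegelLow, siegelLow, conj_inv, ofAdd_neg, map_inv]
    have : sympTransvection (Sum.elim v₁ v₂) t = siegelLow ((-(1 / 2 : F)) • S) *
        siegel (Multiplicative.ofAdd ((-(t / 2)) • vecMulVec v₁ v₁)) *
        siegelLow (-((-(1 / 2 : F)) • S)) := by
      rw [← hinv, ← sympTransvection_sumElim_zero h2, conj_sympTransvection, coe_siegelLow, hB,
        fromBlocks_mulVec]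
      simp [hSv]
    rw [this]
    exact Set.mul_mem_mul (Set.mul_mem_mul (Or.inr ⟨_, rfl⟩) (Or.inl ⟨_, rfl⟩)) (Or.inr ⟨_, rfl⟩)

/-- Bounded generation of the symplectic group of a field by Siegel unipotents. -/
theorem mem_siegel_pow {F : Type*} [Field F] (h2 : (2 : F) ≠ 0) (A : symplecticGroup l F) :
    A ∈ (Set.range (siegel (l := l) (R := F)) ∪ Set.range siegelLow) ^ (12 * Fintype.card l) := by
  have hsub : (Set.range fun p : (l ⊕ l → F) × F => sympTransvection p.1 p.2) ⊆
      (Set.range (siegel (l := l) (R := F)) ∪ Set.range siegelLow) ^ 3 := by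
    rintro _ ⟨p, rfl⟩
    exact sympTransvection_mem_siegel_pow h2 p.1 p.2
  have h := Set.pow_subset_pow_left (n := 2 * (2 * Fintype.card l)) hsub
    (mem_sympTransvection_pow A)
  rwa [← pow_mul, show 3 * (2 * (2 * Fintype.card l)) = 12 * Fintype.card l by ring] at h

theorem norm_map_sub_le_of_mem_pow {G : Type*} [Group G] {V : Type*} [NormedAddCommGroup V]
    [InnerProductSpace ℂ V] (ρ : G →* (V ≃ₗᵢ[ℂ] V)) (v : V) {E : Set G} {c : ℝ}
    (hE : ∀ x ∈ E, ‖ρ x v - v‖ ≤ c) (n : ℕ) {x : G} (hx : x ∈ E ^ n) :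
    ‖ρ x v - v‖ ≤ n * c := by
  induction n generalizing x with
  | zero =>
    rw [pow_zero, Set.mem_one] at hx
    simp [hx]
  | succ n ih =>
    rw [pow_succ] at hx
    obtain ⟨a, ha, b, hb, rfl⟩ := Set.mem_mul.1 hx
    refine (norm_map_mul_sub_le ρ a b v).trans ?_
    push_cast
    linarith [ih ha, hE b hb]

end Siegel

section Levi

open Matrix Multiplicative

variable {l R : Type*} [DecidableEq l] [Fintype l] [CommRing R]

/-- The block diagonal symplectic matrix attached to the elementary matrix `1 + E i j`. -/
def levi {i j : l} (h : i ≠ j) : symplecticGroup l R :=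
  ⟨fromBlocks (transvection i j 1) 0 0 (transvection j i (-1)), by
    rw [SymplecticGroup.fromBlocks_mem_iff]
    have : (transvection i j (1 : R))ᵀ = transvection j i 1 := by
      simp [transvection, transpose_add, transpose_single]
    simp [this, transvection_mul_transvection_same j i h.symm]⟩

theorem siegel_transpose (B : Matrix l l R) : siegel (ofAdd Bᵀ) = siegel (ofAdd B) := by
  refine Subtype.ext ?_
  rw [coe_siegel, coe_siegel, transpose_transpose, add_comm]

theorem levi_mul_siegel {i j : l} (h : i ≠ j) (B : Matrix l l R) :
    levi h * siegel (ofAdd B) =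
      siegel (ofAdd (transvection i j 1 * B * transvection j i 1)) * levi h := by
  have hT : (transvection i j (1 : R))ᵀ = transvection j i 1 := by
    simp [transvection, transpose_add, transpose_single]
  have hT' : (transvection j i (1 : R))ᵀ = transvection i j 1 := by
    simp [transvection, transpose_add, transpose_single]
  have h1 : transvection j i (1 : R) * transvection j i (-1) = 1 := by
    simp [transvection_mul_transvection_same j i h.symm]
  refine Subtype.ext ?_
  rw [Submonoid.coe_mul, Submonoid.coe_mul, coe_siegel, coe_siegel, levi]
  simp only [fromBlocks_multiply, transpose_mul, hT, hT', Matrix.mul_one, Matrix.mul_zero,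
    Matrix.zero_mul, Matrix.one_mul, add_zero, zero_add]
  congr 1
  rw [Matrix.add_mul, ← Matrix.mul_assoc (transvection i j 1), Matrix.mul_assoc _ _
    (transvection j i (-1)), h1, Matrix.mul_assoc _ _ (transvection j i (-1)), h1]
  simp [Matrix.mul_add]

/-- The matrix of the binary form with coefficients `(a, b, c)` in the variables `i` and `j`. -/
def binaryForm (R : Type*) [CommRing R] (i j : l) : R × R × R →+ Matrix l l R where
  toFun p := single i i p.1 + single i j p.2.1 + single j j p.2.2
  map_zero' := by simp
  map_add' p q := by
    simp only [Prod.fst_add, Prod.snd_add, single_add]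
    abel

/-- The action of `x ↦ x + y` on binary forms. -/
def binaryShear (R : Type*) [CommRing R] : R × R × R ≃+ R × R × R where
  toFun p := (p.1 + p.2.1 + p.2.2, p.2.1 + (p.2.2 + p.2.2), p.2.2)
  invFun p := (p.1 - p.2.1 + p.2.2, p.2.1 - (p.2.2 + p.2.2), p.2.2)
  left_inv p := by ext <;> simp; ring
  right_inv p := by ext <;> simp; ring
  map_add' p q := by ext <;> simp <;> ring

/-- The exchange of the two variables of a binary form. -/
def binarySwap (R : Type*) [CommRing R] : R × R × R ≃+ R × R × R where
  toFun p := (p.2.2, p.2.1, p.1)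
  invFun p := (p.2.2, p.2.1, p.1)
  left_inv _ := rfl
  right_inv _ := rfl
  map_add' _ _ := rfl

theorem levi_mul_siegel_binaryForm {i j : l} (h : i ≠ j) (p : R × R × R) :
    levi h * siegel (ofAdd (binaryForm R i j p)) =
      siegel (ofAdd (binaryForm R i j (binaryShear R p))) * levi h := by
  rw [levi_mul_siegel h]
  congr 1
  obtain ⟨a, b, c⟩ := p
  have : transvection i j 1 * binaryForm R i j (a, b, c) * transvection j i 1 =
      single i i (a + b + c) + single i j (b + c) + single j j c + (single i j c)ᵀ := by
    simp only [binaryForm, AddMonoidHom.coe_mk, ZeroHom.coe_mk, transvection, Matrix.add_mul,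
      Matrix.mul_add, Matrix.zero_mul, single_mul_single_same, one_mul, mul_one,
      single_mul_single_of_ne _ _ _ _ h, single_mul_single_of_ne _ _ _ _ h.symm,
      transpose_single, single_add]
    abel
  rw [this, ofAdd_add, map_mul, siegel_transpose, ← map_mul, ← ofAdd_add]
  congr 2
  simp only [binaryForm, binaryShear, AddMonoidHom.coe_mk, ZeroHom.coe_mk, AddEquiv.coe_mk,
    Equiv.coe_fn_mk, single_add]
  abel

theorem siegel_binaryForm_swap (i j : l) (p : R × R × R) :
    siegel (ofAdd (binaryForm R i j (binarySwap R p))) = siegel (ofAdd (binaryForm R j i p)) := by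
  have : binaryForm R i j (binarySwap R p) = (binaryForm R j i p)ᵀ := by
    simp only [binaryForm, binarySwap, AddMonoidHom.coe_mk, ZeroHom.coe_mk, AddEquiv.coe_mk,
      Equiv.coe_fn_mk, transpose_add, transpose_single]
    abel
  rw [this, siegel_transpose]

variable {N : ℕ} [NeZero N] {V : Type*} [NormedAddCommGroup V] [InnerProductSpace ℂ V]

theorem norm_map_siegel_binaryForm_sub_sq_le
    (ρ : symplecticGroup l (ZMod N) →* (V ≃ₗᵢ[ℂ] V)) {v : V} {ε : ℝ} (hε : 0 ≤ ε) (hε1 : ε ≤ 1)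
    (hlevi : ∀ (i j : l) (h : i ≠ j), ‖ρ (levi h) v - v‖ ≤ ε * ‖v‖)
    (hsiegel : ∀ i j : l, ‖ρ (siegel (ofAdd (single i j 1))) v - v‖ ≤ ε * ‖v‖)
    {i j : l} (h : i ≠ j) (p : ZMod N × ZMod N × ZMod N) :
    ‖ρ (siegel (ofAdd (binaryForm (ZMod N) i j p))) v - v‖ ^ 2 ≤ 10 ^ 8 * ε * ‖v‖ ^ 2 := by
  let n : Multiplicative (ZMod N × ZMod N × ZMod N) →* (V ≃ₗᵢ[ℂ] V) :=
    ρ.comp (siegel.comp (AddMonoidHom.toMultiplicative (binaryForm (ZMod N) i j)))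
  have hn : ∀ p, n (ofAdd p) = ρ (siegel (ofAdd (binaryForm (ZMod N) i j p))) := fun _ => rfl
  let τ := binaryShear (ZMod N)
  let τ' := ((binarySwap (ZMod N)).trans τ).trans (binarySwap (ZMod N))
  refine norm_map_sub_sq_le_of_binaryForm n (ρ (levi h)) (ρ (levi h.symm)) τ τ' ?_ ?_
    (AddMonoidHom.inl _ _) ((AddMonoidHom.inr _ _).comp (AddMonoidHom.inl _ _))
    ((AddMonoidHom.inr _ _).comp (AddMonoidHom.inr _ _)) ?_ ?_ ?_ ?_ ?_ ?_ ?_ hε hε1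
    (hlevi i j h) (hlevi j i h.symm) ?_ ?_ ?_ p
  · intro a w
    rw [hn, hn, ← isometryRep_mul_apply, ← isometryRep_mul_apply, levi_mul_siegel_binaryForm]
  · intro a w
    rw [hn, hn, ← isometryRep_mul_apply, ← isometryRep_mul_apply]
    change ρ (levi h.symm * siegel (ofAdd (binaryForm (ZMod N) i j a))) w = ρ (siegel (ofAdd
      (binaryForm (ZMod N) i j (binarySwap _ (binaryShear _ (binarySwap _ a))))) * levi h.symm) w
    rw [siegel_binaryForm_swap, ← levi_mul_siegel_binaryForm, siegel_binaryForm_swap]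
  · rintro ⟨x, y, z⟩
    exact ⟨x, y, z, by simp⟩
  all_goals first
    | (ext <;> simp [τ, τ', binaryShear, binarySwap])
    | (rw [hn]; simpa [binaryForm] using hsiegel i i)
    | (rw [hn]; simpa [binaryForm] using hsiegel i j)
    | (rw [hn]; simpa [binaryForm] using hsiegel j j)

theorem norm_map_siegel_sub_le [Nontrivial l]
    (ρ : symplecticGroup l (ZMod N) →* (V ≃ₗᵢ[ℂ] V)) {v : V} {δ : ℝ} (hδ : 0 ≤ δ) (hδ1 : δ ≤ 1)
    (hlevi : ∀ (i j : l) (h : i ≠ j), ‖ρ (levi h) v - v‖ ≤ δ ^ 2 / 10 ^ 8 * ‖v‖)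
    (hsiegel : ∀ i j : l, ‖ρ (siegel (ofAdd (single i j 1))) v - v‖ ≤ δ ^ 2 / 10 ^ 8 * ‖v‖)
    (B : Matrix l l (ZMod N)) :
    ‖ρ (siegel (ofAdd B)) v - v‖ ≤ Fintype.card l ^ 2 * (δ * ‖v‖) := by
  have key : ∀ {i j : l}, i ≠ j → ∀ p,
      ‖ρ (siegel (ofAdd (binaryForm (ZMod N) i j p))) v - v‖ ≤ δ * ‖v‖ := by
    intro i j h p
    have := norm_map_siegel_binaryForm_sub_sq_le ρ (by positivity) (by nlinarith) hlevi hsiegel h p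
    rw [show 10 ^ 8 * (δ ^ 2 / 10 ^ 8) * ‖v‖ ^ 2 = (δ * ‖v‖) ^ 2 by ring] at this
    exact le_of_sq_le_sq this (by positivity)
  have hsingle : ∀ (i j : l) (b : ZMod N),
      ‖ρ (siegel (ofAdd (single i j b))) v - v‖ ≤ δ * ‖v‖ := by
    intro i j b
    by_cases h : i = j
    · subst h
      obtain ⟨k, hk⟩ := exists_ne i
      simpa [binaryForm] using key hk.symm (b, 0, 0)
    · simpa [binaryForm] using key h (0, b, 0)
  have hsum : ∀ (s : Finset (l × l)),
      ‖ρ (siegel (ofAdd (∑ p ∈ s, single p.1 p.2 (B p.1 p.2)))) v - v‖ ≤ s.card * (δ * ‖v‖) := by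
    intro s
    induction s using Finset.induction_on with
    | empty => simp
    | insert p s hp ih =>
      rw [Finset.sum_insert hp, ofAdd_add, map_mul, Finset.card_insert_of_notMem hp]
      refine (norm_map_mul_sub_le ρ _ _ v).trans ?_
      push_cast
      linarith [hsingle p.1 p.2 (B p.1 p.2)]
  have := hsum Finset.univ
  rw [Fintype.sum_prod_type, ← matrix_eq_sum_single B] at this
  simpa [sq] using this

end Levi

section Expansion

open Matrix Multiplicative

variable {l : Type} [DecidableEq l] [Fintype l]

noncomputable instance symplecticGroupFintype (R : Type*) [CommRing R] [Finite R] :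
    Fintype (symplecticGroup l R) := Fintype.ofFinite _

/-- Functoriality of the symplectic group in the ring of coefficients. -/
def symplecticMap {R S : Type*} [CommRing R] [CommRing S] (f : R →+* S) :
    symplecticGroup l R →* symplecticGroup l S where
  toFun A := ⟨A.1.map f, SymplecticGroup.map_mem A.2 f⟩
  map_one' := Subtype.ext (by simp)
  map_mul' A B := Subtype.ext (by simp)

theorem symplecticMap_siegel {R S : Type*} [CommRing R] [CommRing S] (f : R →+* S)
    (B : Matrix l l R) : symplecticMap f (siegel (ofAdd B)) = siegel (ofAdd (B.map f)) := by
  refine Subtype.ext ?_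
  change (siegel (ofAdd B)).1.map f = _
  rw [coe_siegel, coe_siegel, fromBlocks_map]
  simp [Matrix.map_add, transpose_map]

theorem symplecticMap_levi {R S : Type*} [CommRing R] [CommRing S] (f : R →+* S)
    {i j : l} (h : i ≠ j) : symplecticMap f (levi h) = levi h := by
  refine Subtype.ext ?_
  change (levi h).1.map f = _
  simp [levi, fromBlocks_map, transvection, Matrix.map_add, map_single]

theorem symplecticMap_symJ {R S : Type*} [CommRing R] [CommRing S] (f : R →+* S) :
    symplecticMap f (SymplecticGroup.symJ l R) = SymplecticGroup.symJ l S :=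
  Subtype.ext (map_J l f)

theorem symplecticMap_siegelLow {R S : Type*} [CommRing R] [CommRing S] (f : R →+* S)
    (B : Matrix l l R) : symplecticMap f (siegelLow B) = siegelLow (B.map f) := by
  rw [siegelLow, map_mul, map_mul, map_inv, symplecticMap_symJ, symplecticMap_siegel, siegelLow]

theorem symplecticMap_comp {R S T : Type*} [CommRing R] [CommRing S] [CommRing T] (f : R →+* S)
    (f' : S →+* T) (A : symplecticGroup l R) :
    symplecticMap f' (symplecticMap f A) = symplecticMap (f'.comp f) A := rfl

theorem norm_le_zero_of_forall_norm_regularRep_sub_le {H : Type} [Group H] [Fintype H]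
    {w : EuclideanSpace ℂ H} (hw : ∑ x, w x = 0)
    (h : ∀ x, ‖regularRep H x w - w‖ ≤ 1 / 2 * ‖w‖) : ‖w‖ ≤ 0 := by
  have hsum : ∑ x, regularRep H x w = 0 := by
    ext y
    rw [WithLp.ofLp_sum, Finset.sum_apply]
    simp only [regularRep_apply, PiLp.zero_apply]
    rw [← hw]
    exact Fintype.sum_equiv ((Equiv.inv H).trans (Equiv.mulRight y)) _ _ fun x => by simp
  have h1 : ‖∑ x : H, (regularRep H x w - w)‖ ≤ Fintype.card H * (1 / 2 * ‖w‖) := by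
    refine (norm_sum_le _ _).trans ((Finset.sum_le_sum fun x _ => h x).trans ?_)
    simp
  rw [Finset.sum_sub_distrib, hsum, zero_sub, norm_neg, Finset.sum_const, Finset.card_univ,
    ← Nat.cast_smul_eq_nsmul ℂ, norm_smul, Complex.norm_natCast] at h1
  have : (0 : ℝ) < Fintype.card H := Nat.cast_pos.2 Fintype.card_pos
  nlinarith [le_of_mul_le_mul_left h1 this]

/-- The Siegel and Levi generators, together with their conjugates by `J`. -/
noncomputable def kazhdanSet (l : Type) [DecidableEq l] [Fintype l] :
    Finset (symplecticGroup l ℤ) := by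
  classical
  exact
    let T := (Finset.univ.image fun p : {p : l × l // p.1 ≠ p.2} => levi (R := ℤ) p.2) ∪
      Finset.univ.image fun p : l × l => siegel (ofAdd (single p.1 p.2 (1 : ℤ)))
    T ∪ T.image fun t => SymplecticGroup.symJ l ℤ * t * (SymplecticGroup.symJ l ℤ)⁻¹

theorem forall_kazhdanSet {P : symplecticGroup l ℤ → Prop} (h : ∀ t ∈ kazhdanSet l, P t) :
    (∀ (i j : l) (h : i ≠ j), P (levi h) ∧
      P (SymplecticGroup.symJ l ℤ * levi h * (SymplecticGroup.symJ l ℤ)⁻¹)) ∧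
    ∀ i j : l, P (siegel (ofAdd (single i j 1))) ∧ P (SymplecticGroup.symJ l ℤ *
      siegel (ofAdd (single i j 1)) * (SymplecticGroup.symJ l ℤ)⁻¹) := by
  classical
  simp only [kazhdanSet, Finset.mem_union, Finset.mem_image, Finset.mem_univ, true_and] at h
  exact ⟨fun i j hij => ⟨h _ (Or.inl (Or.inl ⟨⟨(i, j), hij⟩, rfl⟩)),
      h _ (Or.inr ⟨_, Or.inl ⟨⟨(i, j), hij⟩, rfl⟩, rfl⟩)⟩,
    fun i j => ⟨h _ (Or.inl (Or.inr ⟨(i, j), rfl⟩)),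
      h _ (Or.inr ⟨_, Or.inr ⟨(i, j), rfl⟩, rfl⟩)⟩⟩

/-- Reduction of integral symplectic matrices modulo `p` and modulo `q`. -/
def reductionPair (l : Type) [DecidableEq l] [Fintype l] (p q : ℕ) :
    symplecticGroup l ℤ →* symplecticGroup l (ZMod p) × symplecticGroup l (ZMod q) :=
  (symplecticMap (Int.castRingHom _)).prod (symplecticMap (Int.castRingHom _))

variable {V : Type*} [NormedAddCommGroup V] [InnerProductSpace ℂ V]

theorem norm_map_unipotent_sub_le [Nontrivial l] {N : ℕ} [NeZero N]
    (ρ : symplecticGroup l (ZMod N) →* (V ≃ₗᵢ[ℂ] V)) {v : V} {δ : ℝ} (hδ : 0 ≤ δ) (hδ1 : δ ≤ 1)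
    (h : ∀ t ∈ kazhdanSet l,
      ‖ρ (symplecticMap (Int.castRingHom _) t) v - v‖ ≤ δ ^ 2 / 10 ^ 8 * ‖v‖)
    (B : Matrix l l (ZMod N)) :
    ‖ρ (siegel (ofAdd B)) v - v‖ ≤ Fintype.card l ^ 2 * (δ * ‖v‖) ∧
      ‖ρ (siegelLow B) v - v‖ ≤ Fintype.card l ^ 2 * (δ * ‖v‖) := by
  obtain ⟨h1, h2⟩ := forall_kazhdanSet h
  have hs : ∀ i j : l, (single i j (1 : ℤ)).map (Int.castRingHom (ZMod N)) = single i j 1 :=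
    fun i j => by rw [map_single, map_one]
  simp only [map_mul, map_inv, symplecticMap_symJ, symplecticMap_levi, symplecticMap_siegel,
    hs] at h1 h2
  refine ⟨norm_map_siegel_sub_le ρ hδ hδ1 (fun i j h => (h1 i j h).1) (fun i j => (h2 i j).1) B, ?_⟩
  refine norm_map_siegel_sub_le (ρ.comp (MulAut.conj (SymplecticGroup.symJ l _)).toMonoidHom)
    hδ hδ1 (fun i j h => ?_) (fun i j => ?_) B
  · simpa using (h1 i j h).2
  · simpa using (h2 i j).2

theorem norm_map_sub_le_of_unipotent {F : Type*} [Field F] (h2 : (2 : F) ≠ 0)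
    (ρ : symplecticGroup l F →* (V ≃ₗᵢ[ℂ] V)) {v : V} {c : ℝ}
    (h : ∀ B, ‖ρ (siegel (ofAdd B)) v - v‖ ≤ c ∧ ‖ρ (siegelLow B) v - v‖ ≤ c)
    (A : symplecticGroup l F) : ‖ρ A v - v‖ ≤ 12 * Fintype.card l * c := by
  have := norm_map_sub_le_of_mem_pow ρ v (c := c) ?_ _ (mem_siegel_pow h2 A)
  · exact_mod_cast this
  · rintro _ (⟨B, rfl⟩ | ⟨B, rfl⟩)
    · exact (h B.toAdd).1
    · exact (h B).2

theorem exists_le_norm_regularRep_sub [Nontrivial l] {p q : ℕ} [Fact p.Prime] [Fact q.Prime]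
    (hp : p ≠ 2) (hq : q ≠ 2) (hpq : p ≠ q)
    (w : EuclideanSpace ℂ (symplecticGroup l (ZMod p) × symplecticGroup l (ZMod q)))
    (hw : ∑ x, w x = 0) : ∃ t ∈ kazhdanSet l,
      (1 / (48 * Fintype.card l ^ 3)) ^ 2 / 10 ^ 8 * ‖w‖ ≤
        ‖((regularRep _).comp (reductionPair l p q)) t w - w‖ := by
  by_contra! hcon
  set δ : ℝ := 1 / (48 * Fintype.card l ^ 3) with hδ
  have hl1 : (1 : ℝ) ≤ Fintype.card l := by exact_mod_cast Fintype.card_pos (α := l)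
  have hl3 : (1 : ℝ) ≤ (Fintype.card l : ℝ) ^ 3 := one_le_pow₀ hl1
  have hδ1 : δ ≤ 1 := by
    rw [hδ, div_le_one (by positivity)]
    linarith
  have hcop : p.Coprime q := (Nat.coprime_primes Fact.out Fact.out).2 hpq
  let e := ZMod.chineseRemainder hcop
  let π₁ : ZMod (p * q) →+* ZMod p := (RingHom.fst _ _).comp e.toRingHom
  let π₂ : ZMod (p * q) →+* ZMod q := (RingHom.snd _ _).comp e.toRingHom
  let Φ : symplecticGroup l (ZMod (p * q)) →*
      symplecticGroup l (ZMod p) × symplecticGroup l (ZMod q) :=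
    (symplecticMap π₁).prod (symplecticMap π₂)
  have hΦ : ∀ A, Φ (symplecticMap (Int.castRingHom _) A) = reductionPair l p q A := by
    intro A
    refine Prod.ext ?_ ?_
    · change symplecticMap π₁ _ = symplecticMap _ _
      rw [symplecticMap_comp, Subsingleton.elim (π₁.comp _)]
    · change symplecticMap π₂ _ = symplecticMap _ _
      rw [symplecticMap_comp, Subsingleton.elim (π₂.comp _)]
  have huni := norm_map_unipotent_sub_le ((regularRep _).comp Φ) (v := w) (δ := δ) (by positivity)
    hδ1 fun t ht => by
      rw [MonoidHom.comp_apply, hΦ]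
      exact (hcon t ht).le
  have hlift : ∀ (B₁ : Matrix l l (ZMod p)) (B₂ : Matrix l l (ZMod q)), ∃ B : Matrix l l _,
      B.map π₁ = B₁ ∧ B.map π₂ = B₂ := fun B₁ B₂ =>
    ⟨Matrix.of fun i j => e.symm (B₁ i j, B₂ i j), by ext; simp [π₁], by ext; simp [π₂]⟩
  have hlow : ∀ {R : Type} [CommRing R], siegelLow (0 : Matrix l l R) = 1 := fun {R} _ => by
    simp [siegelLow]
  have h2 : ∀ {r : ℕ} [Fact r.Prime], r ≠ 2 → (2 : ZMod r) ≠ 0 := fun {r} _ hr h => by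
    have : r ∣ 2 := (ZMod.natCast_eq_zero_iff 2 r).1 (by exact_mod_cast h)
    exact hr ((Nat.prime_dvd_prime_iff_eq Fact.out Nat.prime_two).1 this)
  have hp' := norm_map_sub_le_of_unipotent (h2 hp)
    ((regularRep _).comp (MonoidHom.inl _ _)) (v := w) (c := Fintype.card l ^ 2 * (δ * ‖w‖))
    fun B₁ => by
      obtain ⟨B, hB, hB'⟩ := hlift B₁ 0
      convert huni B using 4
      all_goals
        simp [Φ, symplecticMap_siegel, symplecticMap_siegelLow, hB, hB', hlow]
  have hq' := norm_map_sub_le_of_unipotent (h2 hq)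
    ((regularRep _).comp (MonoidHom.inr _ _)) (v := w) (c := Fintype.card l ^ 2 * (δ * ‖w‖))
    fun B₂ => by
      obtain ⟨B, hB, hB'⟩ := hlift 0 B₂
      convert huni B using 4
      all_goals
        simp [Φ, symplecticMap_siegel, symplecticMap_siegelLow, hB, hB', hlow]
  have hw0 := norm_le_zero_of_forall_norm_regularRep_sub_le hw fun x => by
    have hx : x = MonoidHom.inl _ _ x.1 * MonoidHom.inr _ _ x.2 := by simp
    rw [hx]
    refine (norm_map_mul_sub_le _ _ _ w).trans ((add_le_add (hp' x.1) (hq' x.2)).trans_eq ?_)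
    rw [hδ]
    field_simp
    ring
  obtain ⟨i, j, hij⟩ := exists_pair_ne l
  have := ((forall_kazhdanSet hcon).1 i j hij).1
  have h0 : ‖w‖ = 0 := le_antisymm hw0 (norm_nonneg _)
  rw [h0, mul_zero] at this
  exact absurd this (norm_nonneg _).not_gt

/-- Uniform spectral gap for the reductions of the integral symplectic group modulo products of
two distinct odd primes. -/
theorem exists_abs_walkAvg_reductionPair_le [Nontrivial l] (S : Finset (symplecticGroup l ℤ))
    (hS : Admissible S) : ∃ r : ℝ, 0 < r ∧ r < 1 ∧
      ∀ (p q : ℕ) [Fact p.Prime] [Fact q.Prime], p ≠ 2 → q ≠ 2 → p ≠ q → ∀ (k : ℕ)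
        (F : symplecticGroup l (ZMod p) × symplecticGroup l (ZMod q) → ℝ), ∑ x, F x = 0 →
        |walkAvg S k (fun x => F (reductionPair l p q x))| ≤
          r ^ k * ‖(WithLp.toLp 2 fun x => (F x : ℂ) : EuclideanSpace ℂ _)‖ := by
  have hε : (0 : ℝ) < (1 / (48 * Fintype.card l ^ 3)) ^ 2 / 10 ^ 8 := by
    have : (0 : ℝ) < Fintype.card l := Nat.cast_pos.2 Fintype.card_pos
    positivity
  obtain ⟨r, hr, hr1, h⟩ := exists_contraction_of_kazhdan S hS (kazhdanSet l) hε
  refine ⟨r, hr, hr1, fun p q _ _ hp hq hpq k F hF => ?_⟩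
  exact abs_walkAvg_le_of_gap S hS.1 (reductionPair l p q) hr.le (fun w hw =>
    h _ ((regularRep _).comp (reductionPair l p q)) w
      (exists_le_norm_regularRep_sub hp hq hpq w hw)) k F hF

end Expansion

section Torus

open Matrix Polynomial

variable {l : Type} [DecidableEq l] [Fintype l] {F K : Type*} [Field F] [Field K] [Algebra F K]

/-- An intertwiner between a matrix and multiplication by `u` shows that `u` is a root of the
characteristic polynomial. -/
theorem aeval_charpoly_of_intertwining {m : Type*} [DecidableEq m] [Fintype m] (A : Matrix m m F)
    {u : K} (T : (m → F) →ₗ[F] K) (hT : ∀ x, T (A *ᵥ x) = u * T x) {x : m → F} (hx : T x ≠ 0) :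
    aeval u A.charpoly = 0 := by
  have h : ∀ (P : F[X]) x, T (aeval A P *ᵥ x) = aeval u P * T x := by
    intro P
    induction P using Polynomial.induction_on' with
    | add P Q hP hQ => intro x; simp [add_mulVec, hP, hQ, add_mul]
    | monomial n a =>
      intro x
      have hpow : T ((A ^ n) *ᵥ x) = u ^ n * T x := by
        induction n with
        | zero => simp
        | succ n ih => rw [pow_succ', ← mulVec_mulVec, hT, ih, pow_succ']; ring
      rw [aeval_monomial, aeval_monomial, ← mulVec_mulVec, Algebra.algebraMap_eq_smul_one,
        smul_mulVec, one_mulVec, map_smul, hpow, Algebra.smul_def, mul_assoc]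
  have := h A.charpoly x
  rw [aeval_self_charpoly, zero_mulVec, map_zero] at this
  exact (mul_eq_zero.1 this.symm).resolve_right hx

theorem charpoly_eq_minpoly_of_aeval {m : Type*} [DecidableEq m] [Fintype m] {A : Matrix m m F}
    {u : K} (hA : aeval u A.charpoly = 0) (hu : (minpoly F u).natDegree = Fintype.card m) :
    A.charpoly = minpoly F u := by
  have hint : IsIntegral F u := ⟨_, A.charpoly_monic, by rwa [← aeval_def]⟩
  exact eq_of_monic_of_dvd_of_natDegree_le (minpoly.monic hint) A.charpoly_monic
    (minpoly.dvd F u hA) (by rw [charpoly_natDegree_eq_dim, hu])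

theorem exists_symplectic_charpoly_eq_minpoly [Nonempty l] {L : Type*} [Field L] [Algebra F L]
    [Algebra L K] [IsScalarTower F L K] [Algebra.IsSeparable F L] (b : Module.Basis l F L)
    {u : K} (hu0 : u ≠ 0) {θ : L} (hθ : algebraMap L K θ = u + u⁻¹)
    (hu : (minpoly F u).natDegree = 2 * Fintype.card l) :
    ∃ M : symplecticGroup l F, M.1.charpoly = minpoly F u := by
  set H := LinearMap.BilinForm.toMatrix b (Algebra.traceForm F L) with hH
  set D := Algebra.leftMulMatrix b θ with hD
  have hHt : Hᵀ = H := by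
    ext i j
    rw [transpose_apply, hH, LinearMap.BilinForm.toMatrix_apply,
      LinearMap.BilinForm.toMatrix_apply, Algebra.traceForm_apply, Algebra.traceForm_apply,
      mul_comm]
  have hHu : IsUnit H.det := isUnit_iff_ne_zero.2 (det_traceForm_ne_zero b)
  have hDb : ∀ y : l → F, ∑ i, (D *ᵥ y) i • b i = θ * ∑ i, y i • b i := by
    intro y
    have := Algebra.leftMulMatrix_mulVec_repr b θ (∑ i, y i • b i)
    have hy : ⇑(b.repr (∑ i, y i • b i)) = y := by
      ext i
      rw [b.repr_sum_self]
    rw [hy] at this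
    rw [hD, this, b.sum_repr]
  have hHD : ∀ i j, (H * D) i j = Algebra.trace F L (b i * (θ * b j)) := by
    intro i j
    have h1 : θ * b j = ∑ k, D k j • b k := by
      have := hDb (Pi.single j 1)
      simp only [mulVec_single_one, Pi.single_apply, ite_smul, one_smul, zero_smul,
        Finset.sum_ite_eq', Finset.mem_univ, if_true] at this
      rw [← this]
      rfl
    rw [h1, Finset.mul_sum, map_sum, mul_apply]
    refine Finset.sum_congr rfl fun k _ => ?_
    rw [hH, LinearMap.BilinForm.toMatrix_apply, Algebra.traceForm_apply, mul_smul_comm, map_smul,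
      smul_eq_mul, mul_comm]
  have hsymm : (H * D)ᵀ = H * D := by
    ext i j
    rw [transpose_apply, hHD, hHD]
    congr 1
    ring
  refine ⟨⟨fromBlocks 0 (-H) H⁻¹ D, ?_⟩, ?_⟩
  · rw [SymplecticGroup.fromBlocks_mem_iff]
    refine ⟨by simp, ?_, ?_⟩
    · rw [transpose_neg, hHt, Matrix.neg_mul, Matrix.mul_neg]
      rw [transpose_mul, hHt] at hsymm
      rw [hsymm]
    · rw [transpose_nonsing_inv, hHt]
      simp [nonsing_inv_mul _ hHu]
  · let β : (l → F) →ₗ[F] K :=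
      (IsScalarTower.toAlgHom F L K).toLinearMap ∘ₗ (b.equivFun.symm : (l → F) →ₗ[F] L)
    have hβ : ∀ y, β y = algebraMap L K (∑ i, y i • b i) := fun y => by
      simp [β, Module.Basis.equivFun_symm_apply]
    have hβD : ∀ y, β (D *ᵥ y) = (u + u⁻¹) * β y := fun y => by
      rw [hβ, hβ, hDb, map_mul, hθ]
    let T : (l ⊕ l → F) →ₗ[F] K :=
      β ∘ₗ (toLin' H⁻¹) ∘ₗ LinearMap.funLeft F F Sum.inl +
        LinearMap.mulLeft F u ∘ₗ β ∘ₗ LinearMap.funLeft F F Sum.inr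
    have hT : ∀ x y, T (Sum.elim x y) = β (H⁻¹ *ᵥ x) + u * β y := fun x y => rfl
    refine charpoly_eq_minpoly_of_aeval (aeval_charpoly_of_intertwining _ T ?_
      (x := Sum.elim 0 (b.equivFun 1)) ?_) (by rw [hu, Fintype.card_sum, two_mul])
    · intro x
      obtain ⟨x, y, rfl⟩ : ∃ x₁ x₂, x = Sum.elim x₁ x₂ :=
        ⟨x ∘ Sum.inl, x ∘ Sum.inr, (Sum.elim_comp_inl_inr x).symm⟩
      rw [fromBlocks_mulVec, hT, hT]
      simp only [Function.comp_def, Sum.elim_inl, Sum.elim_inr, zero_mulVec, zero_add, map_add,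
        neg_mulVec, mulVec_neg, map_neg, mulVec_mulVec, nonsing_inv_mul _ hHu, one_mulVec, hβD]
      field_simp
      ring
    · rw [hT]
      simp [β, hu0]

theorem exists_powerBasis_gen_eq [FiniteDimensional F K] {u : K}
    (hu : (minpoly F u).natDegree = Module.finrank F K) : ∃ pb : PowerBasis F K, pb.gen = u := by
  have hint := IsIntegral.of_finite F u
  have htop := (Field.primitive_element_iff_minpoly_natDegree_eq F u).2 hu
  have : Algebra.adjoin F {u} = ⊤ := by
    rw [← IntermediateField.adjoin_simple_toSubalgebra_of_isAlgebraic hint.isAlgebraic, htop,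
      IntermediateField.top_toSubalgebra]
  exact ⟨_, PowerBasis.ofAdjoinEqTop_gen hint this⟩

/-- The commutant of a matrix which is cyclic over a field. -/
theorem exists_eq_of_commute [FiniteDimensional F K] {m : Type*} [DecidableEq m] [Fintype m]
    [Nonempty m] (Φ : K →ₐ[F] Matrix m m F) (hK : Module.finrank F K = Fintype.card m)
    {Z : Matrix m m F} (hZ : ∀ z, Z * Φ z = Φ z * Z) : ∃ z, Z = Φ z := by
  set v : m → F := fun _ => 1 with hv
  let ev : K →ₗ[F] (m → F) :=
    { toFun := fun z => Φ z *ᵥ v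
      map_add' := fun x y => by rw [map_add, add_mulVec]
      map_smul' := fun c x => by rw [map_smul, smul_mulVec, RingHom.id_apply] }
  have hinj : Function.Injective ev := by
    rw [← LinearMap.ker_eq_bot, LinearMap.ker_eq_bot']
    intro z hz
    by_contra h0
    have : Φ z⁻¹ *ᵥ (Φ z *ᵥ v) = 0 := by
      change Φ z⁻¹ *ᵥ (ev z) = 0
      rw [hz, mulVec_zero]
    rw [mulVec_mulVec, ← map_mul, inv_mul_cancel₀ h0, map_one, one_mulVec] at this
    exact one_ne_zero (congrFun this (Classical.arbitrary m))
  have hsurj : Function.Surjective ev :=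
    (LinearMap.injective_iff_surjective_of_finrank_eq_finrank (by simp [hK])).1 hinj
  obtain ⟨z, hz⟩ := hsurj (Z *ᵥ v)
  refine ⟨z, ext_of_mulVec_single fun i => ?_⟩
  obtain ⟨w, hw⟩ := hsurj (Pi.single i 1)
  rw [← hw]
  change Z *ᵥ (Φ w *ᵥ v) = Φ z *ᵥ (Φ w *ᵥ v)
  have hz' : Φ z *ᵥ v = Z *ᵥ v := hz
  rw [mulVec_mulVec, mulVec_mulVec, hZ, ← map_mul, mul_comm, map_mul, ← mulVec_mulVec,
    ← mulVec_mulVec, hz']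

theorem card_centralizer_le [Nonempty l] [Finite K] {L : Type*} [Field L] [Fintype L]
    [Algebra F L] [Algebra L K] [IsScalarTower F L K] {u : K}
    (hu : u ^ (Fintype.card L + 1) = 1) (hK : Module.finrank F K = 2 * Fintype.card l)
    (hdeg : (minpoly F u).natDegree = 2 * Fintype.card l) (M : symplecticGroup l F)
    (hM : M.1.charpoly = minpoly F u) :
    Nat.card {Z : symplecticGroup l F // Z * M = M * Z} ≤ Fintype.card L + 1 := by
  classical
  have : FiniteDimensional F K := Module.Finite.of_finite
  have hcard : Module.finrank F K = Fintype.card (l ⊕ l) := by rw [hK, Fintype.card_sum, two_mul]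
  obtain ⟨pb, hpb⟩ := exists_powerBasis_gen_eq (hdeg.trans hK.symm)
  let Φ : K →ₐ[F] Matrix (l ⊕ l) (l ⊕ l) F :=
    pb.lift M.1 (by rw [hpb, ← hM, aeval_self_charpoly])
  have hΦu : Φ u = M.1 := by
    rw [← hpb]
    exact pb.lift_gen _ _
  have hJ : ∀ A B : Matrix (l ⊕ l) (l ⊕ l) F, (-J l F) * (A * B) * J l F =
      ((-J l F) * A * J l F) * ((-J l F) * B * J l F) := by
    intro A B
    have h : J l F * (-J l F) = 1 := by rw [Matrix.mul_neg, J_squared, neg_neg]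
    rw [show ((-J l F) * A * J l F) * ((-J l F) * B * J l F) =
      (-J l F) * A * (J l F * (-J l F)) * B * J l F by simp only [Matrix.mul_assoc], h]
    simp only [Matrix.mul_assoc, Matrix.one_mul]
  have hJ1 : (-J l F) * 1 * J l F = 1 := by
    rw [Matrix.mul_one, Matrix.neg_mul, J_squared, neg_neg]
  let ψ : K →ₐ[F] Matrix (l ⊕ l) (l ⊕ l) F := AlgHom.ofLinearMap
    { toFun := fun z => (-J l F) * (Φ z)ᵀ * J l F
      map_add' := fun x y => by
        rw [map_add, transpose_add, Matrix.mul_add, Matrix.add_mul]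
      map_smul' := fun c x => by
        rw [map_smul, transpose_smul, Matrix.mul_smul, Matrix.smul_mul, RingHom.id_apply] }
    (by
      change (-J l F) * (Φ 1)ᵀ * J l F = 1
      rw [map_one, transpose_one, hJ1])
    (fun x y => by
      change (-J l F) * (Φ (x * y))ᵀ * J l F = _
      rw [mul_comm, map_mul, transpose_mul, hJ]
      rfl)
  have hψ : ψ = Φ.comp ((FiniteField.frobeniusAlgHom L K).restrictScalars F) := by
    refine pb.algHom_ext ?_
    rw [hpb]
    change (-J l F) * (Φ u)ᵀ * J l F = Φ (u ^ Fintype.card L)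
    have h1 : M.1 * Φ (u ^ Fintype.card L) = 1 := by
      rw [← hΦu, ← map_mul, ← pow_succ', hu, map_one]
    rw [hΦu, ← SymplecticGroup.coe_inv, SymplecticGroup.coe_inv']
    exact inv_eq_right_inv h1
  have key : ∀ Z : {Z : symplecticGroup l F // Z * M = M * Z},
      ∃ z : K, Z.1.1 = Φ z ∧ z ∈ nthRootsFinset (Fintype.card L + 1) (1 : K) := by
    rintro ⟨Z, hZ⟩
    have hZM : Z.1 * M.1 = M.1 * Z.1 := congrArg Subtype.val hZ
    have hcomm : ∀ z, Z.1 * Φ z = Φ z * Z.1 := by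
      intro z
      obtain ⟨P, rfl⟩ := pb.exists_eq_aeval' z
      rw [hpb, ← aeval_algHom_apply, hΦu]
      exact (Polynomial.aeval_eq_sum_range (p := P) M.1 ▸ Commute.sum_right _ _ _ fun i _ =>
        ((show Commute Z.1 M.1 from hZM).pow_right i).smul_right _ : Commute Z.1 (aeval M.1 P))
    obtain ⟨z, hz⟩ := exists_eq_of_commute Φ hcard hcomm
    refine ⟨z, hz, ?_⟩
    rw [mem_nthRootsFinset (Nat.succ_pos _)]
    refine Φ.toRingHom.injective ?_
    change Φ (z ^ (Fintype.card L + 1)) = Φ 1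
    have h1 : ψ z = Φ (z ^ Fintype.card L) := by rw [hψ]; rfl
    have h2 : ψ z = (Z⁻¹ : symplecticGroup l F).1 := by
      rw [SymplecticGroup.coe_inv, hz]
      rfl
    rw [pow_succ', map_mul, ← h1, h2, ← hz, ← Submonoid.coe_mul, mul_inv_cancel, map_one]
    rfl
  choose ζ hζ hζ' using key
  have hinj : Function.Injective fun Z => (⟨ζ Z, hζ' Z⟩ :
      nthRootsFinset (Fintype.card L + 1) (1 : K)) := by
    intro Z Z' h
    have : ζ Z = ζ Z' := congrArg Subtype.val h
    exact Subtype.ext (Subtype.ext (by rw [hζ, hζ, this]))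
  refine (Nat.card_le_card_of_injective _ hinj).trans ?_
  rw [Nat.card_eq_fintype_card, Fintype.card_coe, nthRootsFinset_def]
  exact (Multiset.toFinset_card_le _).trans (card_nthRoots _ _)

end Torus

section NormOneElements

open Polynomial

variable {p g : ℕ} [Fact p.Prime] {K : Type*} [Field K] [Finite K] [Algebra (ZMod p) K]

theorem card_nthRootsFinset_pow_add_one (hK : Module.finrank (ZMod p) K = 2 * g) :
    (nthRootsFinset (p ^ g + 1) (1 : K)).card = p ^ g + 1 := by
  classical
  have hp : 2 ≤ p := (Fact.out : p.Prime).two_le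
  have hc : Nat.card K = (p ^ g) ^ 2 := by
    rw [← FiniteField.pow_finrank_eq_natCard p K, hK, ← pow_mul, mul_comm]
  obtain ⟨ζ, hζ⟩ := IsCyclic.exists_generator (α := Kˣ)
  have hord : orderOf ζ = (p ^ g - 1) * (p ^ g + 1) := by
    rw [orderOf_eq_card_of_forall_mem_zpowers hζ, Nat.card_units, hc, mul_comm,
      ← Nat.sq_sub_sq, one_pow]
  have hprim : IsPrimitiveRoot (ζ : K) ((p ^ g - 1) * (p ^ g + 1)) := by
    rw [← hord]
    exact (IsPrimitiveRoot.coe_units_iff).2 (IsPrimitiveRoot.orderOf ζ)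
  refine (hprim.pow ?_ rfl).card_nthRootsFinset
  rw [← hord]
  exact orderOf_pos ζ

theorem card_natDegree_minpoly_ne_le (hg : 1 ≤ g) (hK : Module.finrank (ZMod p) K = 2 * g) :
    ((nthRootsFinset (p ^ g + 1) (1 : K)).filter fun u =>
      (minpoly (ZMod p) u).natDegree ≠ 2 * g).card ≤ 2 + g * p ^ (g - 1) := by
  classical
  have hp : p.Prime := Fact.out
  have hpK : (Finset.Ico 1 g).card ≤ g := by simp
  have hsub : ((nthRootsFinset (p ^ g + 1) (1 : K)).filter fun u =>
      (minpoly (ZMod p) u).natDegree ≠ 2 * g) ⊆ nthRootsFinset 2 (1 : K) ∪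
        (Finset.Ico 1 g).biUnion fun d => (X ^ p ^ d - X : K[X]).roots.toFinset := by
    intro u hu
    rw [Finset.mem_filter, mem_nthRootsFinset (Nat.succ_pos _)] at hu
    obtain ⟨hu1, hu2⟩ := hu
    have hint := IsIntegral.of_finite (ZMod p) u
    have hfin := IntermediateField.adjoin.finrank hint
    have hdvd : (minpoly (ZMod p) u).natDegree ∣ 2 * g := by
      rw [← hK]
      exact minpoly.degree_dvd hint
    set d := (minpoly (ZMod p) u).natDegree with hd
    have hd0 : 0 < d := minpoly.natDegree_pos hint
    have hpow : u ^ p ^ d = u := by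
      have hc : Nat.card (IntermediateField.adjoin (ZMod p) {u}) = p ^ d := by
        rw [← FiniteField.pow_finrank_eq_natCard p, hfin]
      have := Fintype.ofFinite (IntermediateField.adjoin (ZMod p) {u})
      have h := FiniteField.pow_card (IntermediateField.AdjoinSimple.gen (ZMod p) u)
      rw [← Nat.card_eq_fintype_card, hc] at h
      simpa using congrArg Subtype.val h
    have hdg : d ≤ g := by
      obtain ⟨c, hc⟩ := hdvd
      have hc1 : c ≠ 1 := fun h => hu2 (by rw [hc, h, mul_one])
      have hc0 : c ≠ 0 := fun h => by rw [h, mul_zero] at hc; omega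
      have : d * 2 ≤ d * c := Nat.mul_le_mul_left _ (by omega)
      omega
    rw [Finset.mem_union]
    rcases hdg.eq_or_lt with h | h
    · left
      rw [mem_nthRootsFinset two_pos, sq]
      rwa [pow_succ, ← h, hpow] at hu1
    · right
      rw [Finset.mem_biUnion]
      refine ⟨d, Finset.mem_Ico.2 ⟨hd0, h⟩, ?_⟩
      rw [Multiset.mem_toFinset, mem_roots (FiniteField.X_pow_card_pow_sub_X_ne_zero K hd0.ne'
        hp.one_lt)]
      simp [hpow]
  refine (Finset.card_le_card hsub).trans ((Finset.card_union_le _ _).trans (add_le_add ?_ ?_))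
  · rw [nthRootsFinset_def]
    exact (Multiset.toFinset_card_le _).trans (card_nthRoots _ _)
  · refine Finset.card_biUnion_le.trans ((Finset.sum_le_card_nsmul _ _ (p ^ (g - 1)) ?_).trans ?_)
    · intro d hd
      rw [Finset.mem_Ico] at hd
      refine (Multiset.toFinset_card_le _).trans ((card_roots' _).trans ?_)
      rw [FiniteField.X_pow_card_pow_sub_X_natDegree_eq K (by omega) hp.one_lt]
      exact Nat.pow_le_pow_right hp.pos (by omega)
    · rw [smul_eq_mul]
      exact Nat.mul_le_mul_right _ hpK

theorem card_trace_eq_le (hg : 1 ≤ g) (hK : Module.finrank (ZMod p) K = 2 * g) (t : ZMod p) :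
    ((nthRootsFinset (p ^ g + 1) (1 : K)).filter fun u =>
      Algebra.trace (ZMod p) K u = t).card ≤ 2 * p ^ (g - 1) := by
  classical
  have hp : p.Prime := Fact.out
  have hle : ∀ i ∈ Finset.range g, p ^ i ≤ p ^ (g - 1) := fun i hi =>
    Nat.pow_le_pow_right hp.pos (by have := Finset.mem_range.1 hi; omega)
  set P : K[X] := ∑ i ∈ Finset.range g, X ^ (p ^ (g - 1) + p ^ i) +
    ∑ i ∈ Finset.range g, X ^ (p ^ (g - 1) - p ^ i) -
      C (algebraMap (ZMod p) K t) * X ^ p ^ (g - 1) with hP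
  have hP0 : P ≠ 0 := by
    intro h
    have h0 : P.eval 0 = 1 := by
      have h1 : ∀ i ∈ Finset.range g, (0 : K) ^ (p ^ (g - 1) - p ^ i) =
          if i = g - 1 then 1 else 0 := by
        intro i hi
        split_ifs with h
        · simp [h]
        · have : p ^ i < p ^ (g - 1) := Nat.pow_lt_pow_right hp.one_lt (by
            have := Finset.mem_range.1 hi; omega)
          exact zero_pow (by omega)
      have h2 : ∀ i, (0 : K) ^ (p ^ (g - 1) + p ^ i) = 0 := fun i =>
        zero_pow (by have := pow_pos hp.pos i; omega)
      rw [hP]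
      simp only [eval_sub, eval_add, eval_finsetSum, eval_pow, eval_X, eval_mul, eval_C]
      rw [Finset.sum_congr rfl h1, Finset.sum_congr rfl fun i _ => h2 i]
      simp [hp.ne_zero, show g - 1 < g by omega]
    rw [h, eval_zero] at h0
    exact zero_ne_one h0
  have hdeg : P.natDegree ≤ 2 * p ^ (g - 1) := by
    refine (natDegree_sub_le_of_le (natDegree_add_le_of_degree_le ?_ ?_) ?_).trans (max_self _).le
    · refine natDegree_sum_le_of_forall_le _ _ fun i hi => ?_
      rw [natDegree_X_pow]
      have := hle i hi
      omega
    · refine natDegree_sum_le_of_forall_le _ _ fun i hi => ?_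
      rw [natDegree_X_pow]
      omega
    · refine (natDegree_C_mul_X_pow_le _ _).trans ?_
      omega
  have hsub : ((nthRootsFinset (p ^ g + 1) (1 : K)).filter fun u =>
      Algebra.trace (ZMod p) K u = t) ⊆ P.roots.toFinset := by
    intro u hu
    rw [Finset.mem_filter, mem_nthRootsFinset (Nat.succ_pos _)] at hu
    obtain ⟨hu1, hu2⟩ := hu
    rw [Multiset.mem_toFinset, mem_roots hP0, IsRoot.def, hP]
    simp only [eval_sub, eval_add, eval_finsetSum, eval_pow, eval_X, eval_mul, eval_C]
    have htr := FiniteField.algebraMap_trace_eq_sum_pow (ZMod p) K u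
    rw [hu2, hK, two_mul, Finset.sum_range_add, Nat.card_zmod] at htr
    rw [htr, add_mul, Finset.sum_mul, Finset.sum_mul, sub_eq_zero]
    congr 1
    · exact Finset.sum_congr rfl fun i _ => by rw [pow_add, mul_comm]
    · refine Finset.sum_congr rfl fun i hi => ?_
      have h1 : u ^ p ^ (g + i) * u ^ p ^ i = 1 := by
        rw [pow_add, pow_mul, ← mul_pow, ← pow_succ, hu1, one_pow]
      calc u ^ (p ^ (g - 1) - p ^ i) =
          u ^ (p ^ (g - 1) - p ^ i) * (u ^ p ^ (g + i) * u ^ p ^ i) := by rw [h1, mul_one]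
        _ = u ^ p ^ (g + i) * (u ^ (p ^ (g - 1) - p ^ i) * u ^ p ^ i) := by ring
        _ = _ := by rw [← pow_add u (p ^ (g - 1) - p ^ i), Nat.sub_add_cancel (hle i hi)]
  exact (Finset.card_le_card hsub).trans ((Multiset.toFinset_card_le _).trans
    ((card_roots' _).trans hdeg))

/-- Most elements of norm one generate the field and have trace outside a given small set. -/
theorem le_two_mul_card_norm_one (hg : 1 ≤ g) (hK : Module.finrank (ZMod p) K = 2 * g)
    (s : Finset (ZMod p)) (hs : 2 * (g + 2 + 2 * s.card) ≤ p) :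
    p ^ g + 1 ≤ 2 * ((nthRootsFinset (p ^ g + 1) (1 : K)).filter fun u =>
      (minpoly (ZMod p) u).natDegree = 2 * g ∧ Algebra.trace (ZMod p) K u ∉ s).card := by
  classical
  set U := nthRootsFinset (p ^ g + 1) (1 : K)
  have hp : p.Prime := Fact.out
  have hsub : U ⊆ (U.filter fun u => (minpoly (ZMod p) u).natDegree = 2 * g ∧
      Algebra.trace (ZMod p) K u ∉ s) ∪
      ((U.filter fun u => (minpoly (ZMod p) u).natDegree ≠ 2 * g) ∪
        s.biUnion fun t => U.filter fun u => Algebra.trace (ZMod p) K u = t) := by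
    intro u hu
    simp only [Finset.mem_union, Finset.mem_filter, Finset.mem_biUnion, hu, true_and]
    by_cases h1 : (minpoly (ZMod p) u).natDegree = 2 * g
    · by_cases h2 : Algebra.trace (ZMod p) K u ∈ s
      · exact Or.inr (Or.inr ⟨_, h2, rfl⟩)
      · exact Or.inl ⟨h1, h2⟩
    · exact Or.inr (Or.inl h1)
  have hU : U.card = p ^ g + 1 := card_nthRootsFinset_pow_add_one hK
  have h1 := (Finset.card_le_card hsub).trans (Finset.card_union_le _ _)
  have h2 := Finset.card_union_le (U.filter fun u => (minpoly (ZMod p) u).natDegree ≠ 2 * g)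
    (s.biUnion fun t => U.filter fun u => Algebra.trace (ZMod p) K u = t)
  have h3 : (s.biUnion fun t => U.filter fun u => Algebra.trace (ZMod p) K u = t).card ≤
      s.card * (2 * p ^ (g - 1)) :=
    Finset.card_biUnion_le.trans ((Finset.sum_le_card_nsmul _ _ _ fun t _ =>
      card_trace_eq_le hg hK t).trans_eq (smul_eq_mul _ _))
  have h4 := card_natDegree_minpoly_ne_le (K := K) hg hK
  have h5 : 2 * (g + 2 + 2 * s.card) * p ^ (g - 1) ≤ p ^ g := by
    rw [← Nat.sub_add_cancel hg, pow_succ', Nat.add_sub_cancel, Nat.sub_add_cancel hg]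
    exact Nat.mul_le_mul_right _ hs
  have h6 : 1 ≤ p ^ (g - 1) := Nat.one_le_pow _ _ hp.pos
  rw [hU] at h1
  nlinarith

end NormOneElements

section Density

open Matrix Polynomial

/-- A count of conjugates: if `M` is a family of elements with small centralizers such that each
element is conjugate to few members of the family, then the conjugates of the members fill up a
large subset of the group. -/
theorem card_mul_card_le_of_conj_mem {G U : Type*} [Group G] [Fintype G] (s : Finset U) (M : U → G)
    (T : Finset G) {a c : ℕ} (hT : ∀ h, ∀ u ∈ s, h * M u * h⁻¹ ∈ T)
    (ha : ∀ (N : G) (t : Finset U), (∀ u ∈ t, u ∈ s ∧ IsConj (M u) N) → t.card ≤ a)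
    (hc : ∀ u ∈ s, Nat.card {z : G // z * M u = M u * z} ≤ c) :
    Fintype.card G * s.card ≤ a * c * T.card := by
  classical
  rw [← Finset.card_univ, ← Finset.card_product]
  refine Finset.card_le_mul_card_image_of_maps_to (f := fun x => x.1 * M x.2 * x.1⁻¹)
    (fun x hx => hT _ _ (Finset.mem_product.1 hx).2) _ fun N _ => ?_
  set t := s.filter fun u => IsConj (M u) N with ht
  have h1 : ((Finset.univ ×ˢ s).filter fun x : G × U => x.1 * M x.2 * x.1⁻¹ = N).card ≤
      c * t.card := by
    refine Finset.card_le_mul_card_image_of_maps_to (f := Prod.snd) (fun x hx => ?_) _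
      fun u hu => ?_
    · simp only [Finset.mem_filter, Finset.mem_product, Finset.mem_univ, true_and, ht] at hx ⊢
      exact ⟨hx.1, isConj_iff.2 ⟨x.1, hx.2⟩⟩
    · obtain ⟨hu, h0, hh0⟩ := by simpa [ht, isConj_iff] using hu
      refine le_trans ?_ (hc u hu)
      rw [Nat.card_eq_fintype_card, Fintype.card_subtype]
      refine Finset.card_le_card_of_injOn (fun x => h0⁻¹ * x.1) (fun x hx => ?_)
        fun x hx y hy hxy => ?_
      · obtain ⟨⟨-, hN⟩, rfl⟩ := by simpa using hx
        have : x.1 * M x.2 = h0 * M x.2 * h0⁻¹ * x.1 := by rw [hh0, ← hN]; group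
        simp only [Finset.coe_filter, Finset.mem_univ, true_and, Set.mem_ofPred_eq]
        rw [mul_assoc, this]
        group
      · obtain ⟨-, rfl⟩ := by simpa using hx
        obtain ⟨-, hy⟩ := by simpa using hy
        exact Prod.ext (mul_left_cancel hxy) hy.symm
  rw [mul_comm a c]
  exact h1.trans (Nat.mul_le_mul_left _ (ha N t fun u hu => by simpa [ht] using hu))

theorem trace_eq_algebraTrace {F K m : Type*} [Field F] [Field K] [Algebra F K]
    [FiniteDimensional F K] [DecidableEq m] [Fintype m] {u : K}
    (hu : (minpoly F u).natDegree = Module.finrank F K) {A : Matrix m m F}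
    (hA : A.charpoly = minpoly F u) : A.trace = Algebra.trace F K u := by
  have hint : IsIntegral F u := Algebra.IsIntegral.isIntegral u
  have hpos : 0 < Module.finrank F K := Module.finrank_pos
  have h1 : Module.finrank (IntermediateField.adjoin F {u}) K = 1 := by
    have := Module.finrank_mul_finrank F (IntermediateField.adjoin F {u}) K
    rw [IntermediateField.adjoin.finrank hint, hu] at this
    exact Nat.eq_of_mul_eq_mul_left hpos (by rw [this, mul_one])
  have : Nonempty m := by
    by_contra! h
    have := hA ▸ hu
    rw [charpoly_natDegree_eq_dim, Fintype.card_eq_zero] at this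
    omega
  rw [trace_eq_finrank_mul_minpoly_nextCoeff, h1, trace_eq_neg_charpoly_nextCoeff, hA]
  simp

/-- Over a large prime field, the symplectic matrices having irreducible characteristic polynomial
and trace outside a given small set have positive density. -/
theorem card_symplecticGroup_le {l : Type} [DecidableEq l] [Fintype l] [Nonempty l] (p : ℕ)
    [Fact p.Prime] (s : Finset (ZMod p)) (hs : 2 * (Fintype.card l + 2 + 2 * s.card) ≤ p) :
    Nat.card (symplecticGroup l (ZMod p)) ≤ 4 * Fintype.card l *
      Nat.card {A : symplecticGroup l (ZMod p) // Irreducible A.1.charpoly ∧ A.1.trace ∉ s} := by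
  classical
  set g := Fintype.card l with hg
  have hg0 : g ≠ 0 := Fintype.card_ne_zero
  let L := GaloisField p g
  let K := FiniteField.Extension L p 2
  have hL : Module.finrank (ZMod p) L = g := GaloisField.finrank p hg0
  have hLK : Module.finrank L K = 2 := FiniteField.finrank_extension L p 2
  have hK : Module.finrank (ZMod p) K = 2 * g := by
    rw [← Module.finrank_mul_finrank (ZMod p) L K, hL, hLK, mul_comm]
  have : Fintype L := Fintype.ofFinite L
  have hcL : Fintype.card L = p ^ g := by
    rw [← Nat.card_eq_fintype_card]; exact GaloisField.card p g hg0
  have hfin : Module.finrank (ZMod p) L = Fintype.card l := hL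
  let b : Module.Basis l (ZMod p) L :=
    (Module.finBasis (ZMod p) L).reindex ((finCongr hfin).trans (Fintype.equivFin l).symm)
  set U := (nthRootsFinset (p ^ g + 1) (1 : K)).filter fun u =>
    (minpoly (ZMod p) u).natDegree = 2 * g ∧ Algebra.trace (ZMod p) K u ∉ s with hU
  have hUcard : p ^ g + 1 ≤ 2 * U.card :=
    le_two_mul_card_norm_one (Nat.one_le_iff_ne_zero.2 hg0) hK s hs
  have hpow : ∀ u ∈ U, u ^ (p ^ g + 1) = 1 := fun u hu =>
    (mem_nthRootsFinset (Nat.succ_pos _) 1).1 (Finset.mem_filter.1 hu).1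
  have hM : ∀ u : K, ∃ M : symplecticGroup l (ZMod p),
      u ∈ U → M.1.charpoly = minpoly (ZMod p) u := by
    intro u
    by_cases hu : u ∈ U
    · have h1 := hpow u hu
      have hu0 : u ≠ 0 := by
        rintro rfl
        simp at h1
      have hθ : algebraMap L K (Algebra.trace L K u) = u + u⁻¹ := by
        rw [FiniteField.algebraMap_trace_eq_sum_pow, hLK, Finset.sum_range_succ,
          Finset.sum_range_one, Nat.card_eq_fintype_card, hcL]
        simp only [pow_zero, pow_one, add_right_inj]
        exact eq_inv_of_mul_eq_one_left (by rw [← pow_succ, h1])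
      obtain ⟨M, hM⟩ :=
        exists_symplectic_charpoly_eq_minpoly b hu0 hθ (Finset.mem_filter.1 hu).2.1
      exact ⟨M, fun _ => hM⟩
    · exact ⟨1, fun h => absurd h hu⟩
  choose M hM using hM
  set T := Finset.univ.filter fun A : symplecticGroup l (ZMod p) =>
    Irreducible A.1.charpoly ∧ A.1.trace ∉ s with hT
  have hconj : ∀ A B : symplecticGroup l (ZMod p), IsConj A B → A.1.charpoly = B.1.charpoly := by
    intro A B h
    obtain ⟨c, rfl⟩ := isConj_iff.1 h
    have h1 : (c⁻¹).1 * c.1 = 1 := congrArg Subtype.val (inv_mul_cancel c)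
    change A.1.charpoly = (c.1 * A.1 * (c⁻¹).1).charpoly
    rw [charpoly_mul_comm, ← mul_assoc, h1, one_mul]
  have key := card_mul_card_le_of_conj_mem (a := 2 * g) (c := p ^ g + 1) U M T
    (fun h u hu => ?_) (fun N t ht => ?_) (fun u hu => ?_)
  · have hTc : Nat.card {A : symplecticGroup l (ZMod p) //
        Irreducible A.1.charpoly ∧ A.1.trace ∉ s} = T.card := by
      rw [Nat.card_eq_fintype_card, Fintype.card_subtype]
    rw [Nat.card_eq_fintype_card, hTc]
    have hpos : 0 < p ^ g + 1 := Nat.succ_pos _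
    nlinarith [Nat.mul_le_mul_left (Fintype.card (symplecticGroup l (ZMod p))) hUcard]
  · have hc := (hconj _ _ (isConj_iff.2 ⟨h, rfl⟩)).symm.trans (hM u hu)
    have hd := (Finset.mem_filter.1 hu).2
    refine Finset.mem_filter.2 ⟨Finset.mem_univ _, ?_, ?_⟩
    · rw [hc]
      exact minpoly.irreducible (Algebra.IsIntegral.isIntegral u)
    · rw [trace_eq_algebraTrace (hd.1.trans hK.symm) hc]
      exact hd.2
  · have h0 : N.1.charpoly ≠ 0 := (charpoly_monic _).ne_zero
    refine (Finset.card_le_card (t := (N.1.charpoly.aroots K).toFinset) fun u hu => ?_).trans ?_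
    · rw [Multiset.mem_toFinset, mem_aroots, ← hconj _ _ (ht u hu).2, hM u (ht u hu).1]
      exact ⟨minpoly.ne_zero (Algebra.IsIntegral.isIntegral u), minpoly.aeval _ _⟩
    · refine (Multiset.toFinset_card_le _).trans ((card_roots' _).trans ?_)
      refine natDegree_map_le.trans (le_of_eq ?_)
      rw [charpoly_natDegree_eq_dim, Fintype.card_sum, two_mul]
  · rw [← hcL]
    exact card_centralizer_le (by rw [hcL, hpow u hu]) hK (Finset.mem_filter.1 hu).2.1 _ (hM u hu)

end Density

section BadSet

open Matrix Polynomial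

variable {m : Type*} [DecidableEq m] [Fintype m]

theorem trace_eq_zero_of_charpoly_eq_comp_X_pow {R : Type*} [CommRing R] [IsDomain R] [Nonempty m]
    {A : Matrix m m R} {d : ℕ} (hd : 2 ≤ d) {h : R[X]} (hA : A.charpoly = h.comp (X ^ d)) :
    A.trace = 0 := by
  rw [← expand_eq_comp_X_pow] at hA
  have hdeg : Fintype.card m = h.natDegree * d := by
    rw [← charpoly_natDegree_eq_dim A, hA, natDegree_expand]
  have hpos : 0 < Fintype.card m := Fintype.card_pos
  rw [trace_eq_neg_charpoly_coeff, hA, coeff_expand (by omega), if_neg, neg_zero]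
  intro hdvd
  have h1 : d ∣ Fintype.card m := hdeg ▸ dvd_mul_left _ _
  have := (Nat.dvd_sub h1 hdvd)
  rw [Nat.sub_sub_self hpos, Nat.dvd_one] at this
  omega

theorem abs_trace_le_of_root_of_unity {A : Matrix m m ℤ}
    (hA : Irreducible (A.charpoly.map (Int.castRingHom ℚ))) {k : ℕ} (hk : 1 ≤ k) {ζ : ℂ}
    (hζ : ζ ^ k = 1) (h0 : aeval ζ A.charpoly = 0) : |A.trace| ≤ Fintype.card m := by
  have hroot : aeval ζ (A.charpoly.map (Int.castRingHom ℚ)) = 0 := by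
    rw [← h0]
    exact aeval_map_algebraMap ℚ ζ A.charpoly
  have hdvd : A.charpoly.map (Int.castRingHom ℚ) ∣ X ^ k - 1 := by
    rw [minpoly.eq_of_irreducible_of_monic hA hroot ((charpoly_monic A).map _)]
    exact minpoly.dvd _ _ (by simp [hζ])
  have hdvd' : (A.map (Int.castRingHom ℂ)).charpoly ∣ X ^ k - 1 := by
    have := Polynomial.map_dvd (algebraMap ℚ ℂ) hdvd
    rw [Polynomial.map_map] at this
    rw [charpoly_map]
    convert this using 1
    · congr 1
    · simp
  have htr : ((A.trace : ℤ) : ℂ) = (A.map (Int.castRingHom ℂ)).charpoly.roots.sum := by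
    rw [← trace_eq_sum_roots_charpoly]
    exact (AddMonoidHom.map_trace (Int.castRingHom ℂ).toAddMonoidHom A)
  have hnorm : ‖((A.trace : ℤ) : ℂ)‖ ≤ Fintype.card m := by
    rw [htr]
    refine (norm_multiset_sum_le _).trans ?_
    rw [Multiset.map_congr rfl (g := fun _ => (1 : ℝ)) fun z hz => ?_]
    · simp only [Multiset.map_const', Multiset.sum_replicate, nsmul_eq_mul, mul_one]
      exact_mod_cast (card_roots' _).trans (charpoly_natDegree_eq_dim _).le
    · obtain ⟨q, hq⟩ := hdvd'
      have hz0 := congrArg (eval z) hq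
      rw [eval_mul, (mem_roots'.1 hz).2.eq_zero, zero_mul] at hz0
      exact Complex.norm_eq_one_of_pow_eq_one (n := k) (sub_eq_zero.1 (by simpa using hz0))
        (by omega)
  rw [Complex.norm_intCast] at hnorm
  exact_mod_cast hnorm

/-- The reduction modulo a prime detects that none of the three conditions holds. -/
theorem not_irreducible_and_trace_notMem [Nonempty m] {A : Matrix m m ℤ} (p : ℕ) [Fact p.Prime]
    (hA : ¬ Irreducible (A.charpoly.map (Int.castRingHom ℚ)) ∨
      (∃ k : ℕ, 1 ≤ k ∧ ∃ ζ : ℂ, ζ ^ k = 1 ∧ aeval ζ A.charpoly = 0) ∨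
      ∃ d : ℕ, 2 ≤ d ∧ ∃ h : ℤ[X], A.charpoly = h.comp (X ^ d)) :
    ¬ (Irreducible (A.map (Int.castRingHom (ZMod p))).charpoly ∧
      (A.map (Int.castRingHom (ZMod p))).trace ∉
        (Finset.Icc (-(Fintype.card m : ℤ)) (Fintype.card m)).image
          (Int.castRingHom (ZMod p))) := by
  rintro ⟨hirr, htr⟩
  have hirrQ : Irreducible (A.charpoly.map (Int.castRingHom ℚ)) := by
    rw [charpoly_map] at hirr
    exact ((charpoly_monic A).irreducible_iff_irreducible_map_fraction_map (K := ℚ)).1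
      ((charpoly_monic A).irreducible_of_irreducible_map _ _ hirr)
  have key : ¬ |A.trace| ≤ Fintype.card m := fun h => htr <| Finset.mem_image.2
    ⟨A.trace, Finset.mem_Icc.2 (abs_le.1 h),
      AddMonoidHom.map_trace (Int.castRingHom (ZMod p)).toAddMonoidHom A⟩
  rcases hA with h | ⟨k, hk, ζ, hζ, h0⟩ | ⟨d, hd, h, hh⟩
  · exact h hirrQ
  · exact key (abs_trace_le_of_root_of_unity hirrQ hk hζ h0)
  · exact key (by simp [trace_eq_zero_of_charpoly_eq_comp_X_pow hd hh])

end BadSet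

section Sieve

open Real

theorem exists_sqrt_add_le_primeCounting (m : ℕ) :
    ∃ n₀ : ℕ, ∀ n : ℕ, n₀ ≤ n → √n + m ≤ (Nat.primeCounting n : ℝ) := by
  refine ⟨(10 + m) ^ 4, fun n hn => le_trans ?_ (Chebyshev.pi_ge n)⟩
  set t : ℝ := √(√n) with ht
  have ht2 : t ^ 2 = √n := sq_sqrt (sqrt_nonneg _)
  have ht4 : t ^ 4 = n := by
    rw [show t ^ 4 = (t ^ 2) ^ 2 by ring, ht2, sq_sqrt (Nat.cast_nonneg n)]
  have htm : 10 + (m : ℝ) ≤ t :=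
    le_of_pow_le_pow_left₀ four_ne_zero (sqrt_nonneg _) (by rw [ht4]; exact_mod_cast hn)
  have hm : (0 : ℝ) ≤ m := Nat.cast_nonneg m
  have hn1 : (1 : ℝ) < n := by
    rw [← ht4]
    exact one_lt_pow₀ (by linarith) four_ne_zero
  have hlog : log n ≤ 4 * t := by
    rw [← ht4, log_pow]
    have := log_le_self (show 0 ≤ t from sqrt_nonneg _)
    push_cast
    linarith
  have hlog' : log (n + 1) ≤ 4 * t + 1 := by
    have h1 : log (n + 1) ≤ log (2 * n) := log_le_log (by linarith) (by linarith)
    rw [log_mul two_ne_zero (by linarith)] at h1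
    linarith [log_two_lt_d9]
  rw [le_div_iff₀ (log_pos hn1), ← ht2]
  have h2 : (t ^ 2 + m) * log n ≤ (t ^ 2 + t) * (4 * t) := by
    have := log_pos hn1
    gcongr
    linarith
  have h3 : t ^ 4 * (1 / 2) ≤ n * log 2 := by
    rw [ht4]
    gcongr
    linarith [log_two_gt_d9]
  have h4 : 0 ≤ t - 10 := by linarith
  nlinarith [pow_nonneg h4 2, pow_nonneg h4 3, pow_nonneg h4 4]

theorem primeCounting_le_card_filter_Ioc (m n : ℕ) :
    Nat.primeCounting n ≤ ((Finset.Ioc m n).filter Nat.Prime).card + m := by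
  rw [Nat.primeCounting, Nat.primeCounting', Nat.count_eq_card_filter_range]
  refine (Finset.card_le_card (t := (Finset.Ioc m n).filter Nat.Prime ∪ Finset.Icc 1 m)
    fun x hx => ?_).trans ((Finset.card_union_le _ _).trans (by simp))
  have h1 : x < n + 1 ∧ x.Prime := by simpa using hx
  have h2 := h1.2.one_le
  simp only [Finset.mem_union, Finset.mem_filter, Finset.mem_Ioc, Finset.mem_Icc]
  by_cases h : m < x
  · exact Or.inl ⟨⟨h, by omega⟩, h1.2⟩
  · exact Or.inr ⟨h2, by omega⟩

/-- Optimization of the level of a sieve with exponential error term. -/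
theorem expSmallWrt_of_sieve {G : Type*} [Group G] (S : Finset G) (Z : Set G) {C r : ℝ} {D m : ℕ}
    (hC : 0 ≤ C) (hr0 : 0 < r) (hr1 : r < 1) (hD : 1 ≤ D)
    (h : ∀ k n : ℕ, ((Finset.Ioc m n).filter Nat.Prime).Nonempty →
      walkProb S k Z ≤ C * (1 / ((Finset.Ioc m n).filter Nat.Prime).card + r ^ k * (n : ℝ) ^ D)) :
    ExpSmallWrt S Z := by
  have hD0 : (1 : ℝ) ≤ D := by exact_mod_cast hD
  set β : ℝ := -log r / (2 * D) with hβ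
  have hlog : 0 < -log r := neg_pos.2 (log_neg hr0 hr1)
  have hβ0 : 0 < β := by positivity
  obtain ⟨n₀, hn₀⟩ := exists_sqrt_add_le_primeCounting m
  obtain ⟨K, hK⟩ := exists_nat_gt ((n₀ + 1 : ℝ) / β)
  have hlarge : ∀ k : ℕ, K ≤ k → walkProb S k Z ≤ 3 * C * exp (-(β / 2) * k) := by
    intro k hk
    set n := ⌊exp (β * k)⌋₊ with hn
    have hkn : (n₀ + 1 : ℝ) ≤ exp (β * k) := by
      have h1 : (n₀ + 1 : ℝ) < k * β := by
        rw [← div_lt_iff₀ hβ0]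
        exact hK.trans_le (by exact_mod_cast hk)
      linarith [add_one_le_exp (β * k)]
    have hn1 : n₀ + 1 ≤ n := Nat.le_floor (by exact_mod_cast hkn)
    have hn1' : (1 : ℝ) ≤ n := by exact_mod_cast (Nat.le_add_left 1 n₀).trans hn1
    have hsqrt : 0 < √(n : ℝ) := sqrt_pos.2 (by linarith)
    have hcard : √(n : ℝ) ≤ ((Finset.Ioc m n).filter Nat.Prime).card := by
      have h1 : (Nat.primeCounting n : ℝ) ≤ ((Finset.Ioc m n).filter Nat.Prime).card + m := by
        exact_mod_cast primeCounting_le_card_filter_Ioc m n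
      linarith [hn₀ n (by omega)]
    have hne : ((Finset.Ioc m n).filter Nat.Prime).Nonempty := by
      rw [← Finset.card_pos]
      exact_mod_cast hsqrt.trans_le hcard
    have hmain : exp (β / 2 * k) / 2 ≤ √(n : ℝ) := by
      refine le_sqrt_of_sq_le ?_
      have h1 : exp (β / 2 * k) ^ 2 = exp (β * k) := by
        rw [← exp_nat_mul]; congr 1; push_cast; ring
      have h2 := Nat.lt_floor_add_one (exp (β * k))
      rw [div_pow, h1]
      linarith
    have hfirst : 1 / (((Finset.Ioc m n).filter Nat.Prime).card : ℝ) ≤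
        2 * exp (-(β / 2) * k) := by
      refine (one_div_le_one_div_of_le (by positivity) (hmain.trans hcard)).trans (le_of_eq ?_)
      rw [neg_mul, exp_neg]
      field_simp
    have hsecond : r ^ k * (n : ℝ) ^ D ≤ exp (-(β / 2) * k) := by
      have h1 : (n : ℝ) ^ D ≤ exp (β * k) ^ D := by
        gcongr
        exact Nat.floor_le (exp_pos _).le
      have h2 : r ^ k = exp (-(2 * D * β) * k) := by
        rw [hβ, mul_div_cancel₀ _ (by positivity), neg_neg, mul_comm, exp_nat_mul, exp_log hr0]
      rw [h2]
      refine (mul_le_mul_of_nonneg_left h1 (exp_pos _).le).trans ?_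
      rw [← exp_nat_mul, ← exp_add, exp_le_exp]
      have h3 : β * k ≤ D * (β * k) := le_mul_of_one_le_left (by positivity) hD0
      have h4 : 0 ≤ β * k := by positivity
      linarith
    refine (h k n hne).trans ?_
    calc _ ≤ C * (2 * exp (-(β / 2) * k) + exp (-(β / 2) * k)) := by gcongr
      _ = _ := by ring
  refine ⟨3 * C + exp (β / 2 * K), β / 2, by positivity, by positivity, fun k => ?_⟩
  rw [add_mul]
  rcases le_or_gt K k with hk | hk
  · exact (hlarge k hk).trans (le_add_of_nonneg_right (by positivity))
  · refine (walkProb_le_one S k Z).trans (le_add_of_nonneg_of_le (by positivity) ?_)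
    rw [← exp_add, one_le_exp_iff]
    have : (k : ℝ) ≤ K := by exact_mod_cast hk.le
    nlinarith

end Sieve

section CenteredIndicator

variable {X Y : Type*} [Fintype X] [Fintype Y]

/-- The indicator function of `T`, normalized to have mean zero. -/
noncomputable def centeredIndicator {X : Type*} (T : Set X) (x : X) : ℝ :=
  T.indicator 1 x - (Nat.card T : ℝ) / Nat.card X

theorem sum_centeredIndicator [Nonempty X] (T : Set X) : ∑ x, centeredIndicator T x = 0 := by
  classical
  have hX : (Fintype.card X : ℝ) ≠ 0 := by exact_mod_cast Fintype.card_ne_zero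
  simp only [centeredIndicator, Finset.sum_sub_distrib, Finset.sum_const, Finset.card_univ,
    nsmul_eq_mul, Nat.card_eq_fintype_card, mul_div_cancel₀ _ hX]
  rw [sub_eq_zero, Fintype.card_subtype]
  simp [Set.indicator_apply]

theorem abs_centeredIndicator_le_one {X : Type*} [Finite X] (T : Set X) (x : X) :
    |centeredIndicator T x| ≤ 1 := by
  classical
  have h0 : (0 : ℝ) ≤ (Nat.card T : ℝ) / Nat.card X := by positivity
  have h1 : (Nat.card T : ℝ) / Nat.card X ≤ 1 :=
    div_le_one_of_le₀ (by exact_mod_cast Finite.card_subtype_le _) (by positivity)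
  rw [abs_le, centeredIndicator, Set.indicator_apply]
  split_ifs
  · simp only [Pi.one_apply]; constructor <;> linarith
  · constructor <;> linarith

theorem norm_toLp_mul_le {F : X → ℝ} {H : Y → ℝ} (hF : ∀ x, |F x| ≤ 1) (hH : ∀ y, |H y| ≤ 1) :
    ‖(WithLp.toLp 2 fun x : X × Y => ((F x.1 * H x.2 : ℝ) : ℂ) : EuclideanSpace ℂ (X × Y))‖ ≤
      √((Nat.card X : ℝ) * Nat.card Y) := by
  rw [EuclideanSpace.norm_eq]
  refine Real.sqrt_le_sqrt ((Finset.sum_le_card_nsmul _ _ 1 fun x _ => ?_).trans (le_of_eq ?_))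
  · simp only [Complex.norm_real, Real.norm_eq_abs, abs_mul]
    exact pow_le_one₀ (by positivity) (mul_le_one₀ (hF _) (abs_nonneg _) (hH _))
  · simp [Nat.card_eq_fintype_card]

end CenteredIndicator

section SymplecticSieve

open Matrix

variable {l : Type} [DecidableEq l] [Fintype l]

theorem natCard_symplecticGroup_le (p : ℕ) [NeZero p] :
    Nat.card (symplecticGroup l (ZMod p)) ≤ p ^ (2 * Fintype.card l) ^ 2 := by
  refine (Finite.card_subtype_le _).trans (le_of_eq ?_)
  change Nat.card (l ⊕ l → l ⊕ l → ZMod p) = _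
  simp only [Nat.card_fun, Nat.card_zmod, Nat.card_sum, Nat.card_eq_fintype_card (α := l)]
  rw [← pow_mul]
  congr 1
  ring

/-- Large sieve for the reductions of a random walk on the symplectic group. -/
theorem expSmall_of_reduction_notMem [Nontrivial l] (Z : Set (symplecticGroup l ℤ))
    (T : ∀ p : ℕ, Set (symplecticGroup l (ZMod p))) {c m : ℕ} (hc : 1 ≤ c)
    (hT : ∀ p : ℕ, p.Prime → m < p → Nat.card (symplecticGroup l (ZMod p)) ≤ c * Nat.card (T p))
    (hZ : ∀ p : ℕ, p.Prime → m < p → ∀ A ∈ Z, symplecticMap (Int.castRingHom (ZMod p)) A ∉ T p) :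
    ExpSmall Z := by
  intro S hS
  obtain ⟨r, hr0, hr1, hgap⟩ := exists_abs_walkAvg_reductionPair_le S hS
  have hc0 : (0 : ℝ) < c := by exact_mod_cast hc
  refine expSmallWrt_of_sieve S Z (C := 1 / (1 / (c : ℝ)) ^ 2) (m := max m 2)
    (D := (2 * Fintype.card l) ^ 2) (by positivity) hr0 hr1
    (Nat.one_le_iff_ne_zero.2 (by simp)) fun k n hn => ?_
  refine walkProb_le_of_correlation S k Z _ hn
    (fun p A => centeredIndicator (T p) (symplecticMap (Int.castRingHom (ZMod p)) A))
    (by positivity) (by positivity) (fun p hp A => ?_) (fun p hp A hA => ?_)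
    fun p hp q hq hpq => ?_
  · have := Fact.mk (Finset.mem_filter.1 hp).2
    exact abs_centeredIndicator_le_one _ _
  · obtain ⟨hp, hprime⟩ := Finset.mem_filter.1 hp
    have := Fact.mk hprime
    have hm : m < p := (le_max_left _ _).trans_lt (Finset.mem_Ioc.1 hp).1
    rw [centeredIndicator, Set.indicator_of_notMem (hZ p hprime hm A hA), zero_sub, neg_le_neg_iff,
      div_le_div_iff₀ hc0 (by exact_mod_cast Nat.card_pos), one_mul, mul_comm]
    exact_mod_cast hT p hprime hm
  · obtain ⟨hp, hp'⟩ := Finset.mem_filter.1 hp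
    obtain ⟨hq, hq'⟩ := Finset.mem_filter.1 hq
    rw [Finset.mem_Ioc] at hp hq
    have := Fact.mk hp'
    have := Fact.mk hq'
    have hp2 : 2 < p := (le_max_right _ _).trans_lt hp.1
    have hq2 : 2 < q := (le_max_right _ _).trans_lt hq.1
    have hcard : ∀ q : ℕ, q.Prime → q ≤ n → (Nat.card (symplecticGroup l (ZMod q)) : ℝ) ≤
        (n : ℝ) ^ (2 * Fintype.card l) ^ 2 := by
      intro q hq hqn
      have := Fact.mk hq
      exact_mod_cast (natCard_symplecticGroup_le q).trans (Nat.pow_le_pow_left hqn _)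
    refine (le_abs_self _).trans ((hgap p q hp2.ne' hq2.ne' hpq k
      (fun x => centeredIndicator (T p) x.1 * centeredIndicator (T q) x.2) ?_).trans ?_)
    · rw [Fintype.sum_prod_type, ← Finset.sum_mul_sum, sum_centeredIndicator, zero_mul]
    · refine mul_le_mul_of_nonneg_left ((norm_toLp_mul_le (abs_centeredIndicator_le_one _)
        (abs_centeredIndicator_le_one _)).trans ?_) (pow_nonneg hr0.le _)
      refine Real.sqrt_le_iff.2 ⟨by positivity, ?_⟩
      rw [sq]
      exact mul_le_mul (hcard p hp' hp.2) (hcard q hq' hq.2) (by positivity) (by positivity)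

end SymplecticSieve

theorem nonPA_conditions_expSmall_symplectic (g : ℕ) (hg : 2 ≤ g) :
    ExpSmall {A : Matrix.symplecticGroup (Fin g) ℤ |
      (¬ Irreducible (((A : Matrix (Fin g ⊕ Fin g) (Fin g ⊕ Fin g) ℤ).charpoly).map
          (Int.castRingHom ℚ))) ∨
      (∃ k : ℕ, 1 ≤ k ∧ ∃ ζ : ℂ, ζ ^ k = 1 ∧
          Polynomial.aeval ζ ((A : Matrix (Fin g ⊕ Fin g) (Fin g ⊕ Fin g) ℤ).charpoly) = 0) ∨
      (∃ d : ℕ, 2 ≤ d ∧ ∃ h : Polynomial ℤ,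
          (A : Matrix (Fin g ⊕ Fin g) (Fin g ⊕ Fin g) ℤ).charpoly =
            h.comp (Polynomial.X ^ d))} := by
  have : Nontrivial (Fin g) := Fin.nontrivial_iff_two_le.2 hg
  have hcard : Fintype.card (Fin g ⊕ Fin g) = 2 * g := by simp [two_mul]
  let s : ∀ p : ℕ, Finset (ZMod p) := fun p =>
    (Finset.Icc (-(Fintype.card (Fin g ⊕ Fin g) : ℤ)) (Fintype.card (Fin g ⊕ Fin g))).image
      (Int.castRingHom (ZMod p))
  have hs : ∀ p, (s p).card ≤ 4 * g + 1 := fun p => by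
    refine Finset.card_image_le.trans ?_
    rw [Int.card_Icc, hcard]
    omega
  refine expSmall_of_reduction_notMem _
    (fun p => {A | Irreducible A.1.charpoly ∧ A.1.trace ∉ s p}) (c := 4 * g) (m := 18 * g + 8)
    (by omega) (fun p hp hpm => ?_) (fun p hp _ A hA => ?_)
  · have := Fact.mk hp
    have h := card_symplecticGroup_le (l := Fin g) p (s p)
    rw [Fintype.card_fin] at h
    exact h (by have := hs p; omega)
  · have := Fact.mk hp
    exact not_irreducible_and_trace_notMem p hA
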